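/- arXiv:0906.1215 — 9 statements merged into one kernel-verified Lean document; each statement's English description precedes it below -/
import Mathlib

section
/- Let q ∈ ℂ be nonzero and not a root of unity, and let c₀, c₁, c̄₀, c̄₁, ε₀, ε₁ ∈ ℂ. Define A₀ = c₀ e₀ K₀⁻¹ + c̄₀ f₀ K₀⁻¹ + ε₀ K₀⁻² and A₁ = c₁ e₁ K₁⁻¹ + c̄₁ f₁ K₁⁻¹ + ε₁ K₁⁻². Then for both (i,j) = (0,1) and (i,j) = (1,0) one has A_i³A_j − [3]_q A_i²A_jA_i + [3]_q A_iA_jA_i² − A_jA_i³ = c_i c̄_i (q + q⁻¹)² (A_iA_j − A_jA_i); that is, all structure constants being invariant under q → q⁻¹, the realization obtained by replacing K_i with K_i⁻¹ also satisfies the q-Dolan–Grady relations with the same parameters ρ_i = c_i c̄_i (q + q⁻¹)². -/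
/-- The q-Dolan–Grady relation is linear in its second argument; this is the contribution of a
second argument `w` that q-commutes with `y` and `k` and satisfies the q-Serre relation with `x`. -/
theorem qDolanGrady_of_qSerre {A : Type*} [Ring A] [Algebra ℂ A] (q : ℂ) (hq : q ≠ 0)
    (hq2 : q ^ 2 - 1 ≠ 0) (x y k w : A) (a b s : ℂ)
    (hxy : x * y = q ^ 2 • (y * x) + (q ^ 2 / (q ^ 2 - 1)) • (1 - k * k))
    (hxk : x * k = q ^ 2 • (k * x)) (hyk : y * k = (q ^ 2)⁻¹ • (k * y))
    (hwk : w * k = (q ^ 2)⁻¹ • (k * w)) (hwy : w * y = (q ^ 2)⁻¹ • (y * w))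
    (hserre : x ^ 3 * w - (q ^ 2 + 1 + (q ^ 2)⁻¹) • (x ^ 2 * w * x)
        + (q ^ 2 + 1 + (q ^ 2)⁻¹) • (x * w * x ^ 2) - w * x ^ 3 = 0)
    (X : A) (hX : X = a • x + b • y + s • k) :
    X ^ 3 * w - (q ^ 2 + 1 + (q ^ 2)⁻¹) • (X ^ 2 * w * X)
        + (q ^ 2 + 1 + (q ^ 2)⁻¹) • (X * w * X ^ 2) - w * X ^ 3
      = (a * b * (q + q⁻¹) ^ 2) • (X * w - w * X) := by
  have hxy' (z : A) : x * (y * z)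
      = q ^ 2 • (y * (x * z)) + (q ^ 2 / (q ^ 2 - 1)) • (z - k * (k * z)) := by
    rw [← mul_assoc, hxy]; simp only [add_mul, smul_mul_assoc, sub_mul, one_mul, mul_assoc]
  have hxk' (z : A) : x * (k * z) = q ^ 2 • (k * (x * z)) := by
    rw [← mul_assoc, hxk, smul_mul_assoc, mul_assoc]
  have hyk' (z : A) : y * (k * z) = (q ^ 2)⁻¹ • (k * (y * z)) := by
    rw [← mul_assoc, hyk, smul_mul_assoc, mul_assoc]
  have hwk' (z : A) : w * (k * z) = (q ^ 2)⁻¹ • (k * (w * z)) := by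
    rw [← mul_assoc, hwk, smul_mul_assoc, mul_assoc]
  have hwy' (z : A) : w * (y * z) = (q ^ 2)⁻¹ • (y * (w * z)) := by
    rw [← mul_assoc, hwy, smul_mul_assoc, mul_assoc]
  have hs : x * (x * (x * w)) = (q ^ 2 + 1 + (q ^ 2)⁻¹) • (x * (x * (w * x)))
        - (q ^ 2 + 1 + (q ^ 2)⁻¹) • (x * (w * (x * x))) + w * (x * (x * x)) := by
    simp only [pow_succ, pow_zero, one_mul, mul_assoc] at hserre
    rw [← sub_eq_zero, ← hserre]; module
  rw [hX]
  simp only [pow_succ (_ : A), pow_zero (_ : A), one_mul, mul_one, add_mul, mul_add, sub_mul,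
    mul_sub, smul_mul_assoc, mul_smul_comm, mul_assoc (_ : A), hxy, hxk, hyk, hwk, hwy, hxy', hxk',
    hyk', hwk', hwy', hs]
  match_scalars <;> field_simp <;> ring

/-- The contribution to the q-Dolan–Grady relation of a second argument `w` that q-commutes with
each of `x`, `y` and `k`. -/
theorem qDolanGrady_of_qCommute {A : Type*} [Ring A] [Algebra ℂ A] (q : ℂ) (hq : q ≠ 0)
    (hq2 : q ^ 2 - 1 ≠ 0) (x y k w : A) (a b s : ℂ)
    (hxy : x * y = q ^ 2 • (y * x) + (q ^ 2 / (q ^ 2 - 1)) • (1 - k * k))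
    (hxk : x * k = q ^ 2 • (k * x)) (hyk : y * k = (q ^ 2)⁻¹ • (k * y))
    (hwk : w * k = k * w) (hwy : w * y = (q ^ 2)⁻¹ • (y * w)) (hwx : w * x = q ^ 2 • (x * w))
    (X : A) (hX : X = a • x + b • y + s • k) :
    X ^ 3 * w - (q ^ 2 + 1 + (q ^ 2)⁻¹) • (X ^ 2 * w * X)
        + (q ^ 2 + 1 + (q ^ 2)⁻¹) • (X * w * X ^ 2) - w * X ^ 3
      = (a * b * (q + q⁻¹) ^ 2) • (X * w - w * X) := by
  have hxy' (z : A) : x * (y * z)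
      = q ^ 2 • (y * (x * z)) + (q ^ 2 / (q ^ 2 - 1)) • (z - k * (k * z)) := by
    rw [← mul_assoc, hxy]; simp only [add_mul, smul_mul_assoc, sub_mul, one_mul, mul_assoc]
  have hxk' (z : A) : x * (k * z) = q ^ 2 • (k * (x * z)) := by
    rw [← mul_assoc, hxk, smul_mul_assoc, mul_assoc]
  have hyk' (z : A) : y * (k * z) = (q ^ 2)⁻¹ • (k * (y * z)) := by
    rw [← mul_assoc, hyk, smul_mul_assoc, mul_assoc]
  have hwk' (z : A) : w * (k * z) = k * (w * z) := by
    rw [← mul_assoc, hwk, mul_assoc]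
  have hwy' (z : A) : w * (y * z) = (q ^ 2)⁻¹ • (y * (w * z)) := by
    rw [← mul_assoc, hwy, smul_mul_assoc, mul_assoc]
  have hwx' (z : A) : w * (x * z) = q ^ 2 • (x * (w * z)) := by
    rw [← mul_assoc, hwx, smul_mul_assoc, mul_assoc]
  rw [hX]
  simp only [pow_succ (_ : A), pow_zero (_ : A), one_mul, mul_one, add_mul, mul_add, sub_mul,
    mul_sub, smul_mul_assoc, mul_smul_comm, mul_assoc (_ : A), hxy, hxk, hyk, hwk, hwy, hwx, hxy',
    hxk', hyk', hwk', hwy', hwx']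
  match_scalars <;> field_simp <;> ring

/-- Twisting both arguments by q-commuting elements preserves the q-Serre relation. -/
theorem qSerre_twist {A : Type*} [Ring A] [Algebra ℂ A] (r t : ℂ) (hr : r ≠ 0) (u v m n : A)
    (hmn : n * m = m * n)
    (hum : u * m = r • (m * u)) (hun : u * n = r⁻¹ • (n * u))
    (hvm : v * m = r⁻¹ • (m * v)) (hvn : v * n = r • (n * v))
    (h : u ^ 3 * v - t • (u ^ 2 * v * u) + t • (u * v * u ^ 2) - v * u ^ 3 = 0) :
    (u * m) ^ 3 * (v * n) - t • ((u * m) ^ 2 * (v * n) * (u * m))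
      + t • ((u * m) * (v * n) * (u * m) ^ 2) - (v * n) * (u * m) ^ 3 = 0 := by
  have hmn' (z : A) : n * (m * z) = m * (n * z) := by rw [← mul_assoc, hmn, mul_assoc]
  have hum' (z : A) : u * (m * z) = r • (m * (u * z)) := by
    rw [← mul_assoc, hum, smul_mul_assoc, mul_assoc]
  have hun' (z : A) : u * (n * z) = r⁻¹ • (n * (u * z)) := by
    rw [← mul_assoc, hun, smul_mul_assoc, mul_assoc]
  have hvm' (z : A) : v * (m * z) = r⁻¹ • (m * (v * z)) := by
    rw [← mul_assoc, hvm, smul_mul_assoc, mul_assoc]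
  have hvn' (z : A) : v * (n * z) = r • (n * (v * z)) := by
    rw [← mul_assoc, hvn, smul_mul_assoc, mul_assoc]
  have h' := congrArg (fun z => m * (m * (m * (n * z)))) h
  simp only [pow_succ (_ : A), pow_zero (_ : A), one_mul, mul_add, mul_sub, mul_zero,
    mul_smul_comm, mul_assoc (_ : A)] at h'
  simp only [pow_succ (_ : A), pow_zero (_ : A), one_mul, smul_mul_assoc, mul_smul_comm,
    mul_assoc (_ : A), hum, hvn, hmn', hum', hun', hvm']
  linear_combination (norm := skip) (r ^ 4) • h'
  match_scalars <;> field_simp <;> ring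

/-- Conjugation by a unit acting as a scalar, read as a q-commutation relation. -/
theorem mul_inv_eq_smul_of_conj {A : Type*} [Ring A] [Algebra ℂ A] (U : Aˣ) (u : A) (r : ℂ)
    (h : (U : A) * u * ((U⁻¹ : Aˣ) : A) = r • u) :
    u * ((U⁻¹ : Aˣ) : A) = r • (((U⁻¹ : Aˣ) : A) * u) := by
  rw [← mul_smul_comm, ← h, mul_assoc, Units.inv_mul_cancel_left]


/-- STATEMENT 0: In the level-zero `U_q(sl₂-hat)` setting, the elements
`A_i = c_i e_i K_i⁻¹ + c̄_i f_i K_i⁻¹ + ε_i K_i⁻²` satisfy the q-Dolan–Grady relations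
with parameters `ρ_i = c_i c̄_i (q + q⁻¹)²`, for arbitrary `ε₀, ε₁`. -/
theorem stmt_1 (q : ℂ) (hq0 : q ≠ 0) (hqroot : ∀ n : ℕ, 0 < n → q ^ n ≠ 1)
    (A : Type*) [Ring A] [Algebra ℂ A]
    (e f : Fin 2 → A) (K : Fin 2 → Aˣ)
    (hKcomm : (K 0 : A) * (K 1 : A) = (K 1 : A) * (K 0 : A))
    (hKeK : ∀ i, (K i : A) * e i * (((K i)⁻¹ : Aˣ) : A) = q • e i)
    (hKfK : ∀ i, (K i : A) * f i * (((K i)⁻¹ : Aˣ) : A) = q⁻¹ • f i)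
    (hKeK' : ∀ i j, i ≠ j → (K i : A) * e j * (((K i)⁻¹ : Aˣ) : A) = q⁻¹ • e j)
    (hKfK' : ∀ i j, i ≠ j → (K i : A) * f j * (((K i)⁻¹ : Aˣ) : A) = q • f j)
    (hef : ∀ i, e i * f i - f i * e i
      = (q - q⁻¹)⁻¹ • ((K i : A) ^ 2 - (((K i)⁻¹ : Aˣ) : A) ^ 2))
    (hef' : ∀ i j, i ≠ j → e i * f j = f j * e i)
    (hSerre_e : ∀ i j, i ≠ j →
      e i ^ 3 * e j - (q ^ 2 + 1 + (q ^ 2)⁻¹) • (e i ^ 2 * e j * e i)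
        + (q ^ 2 + 1 + (q ^ 2)⁻¹) • (e i * e j * e i ^ 2) - e j * e i ^ 3 = 0)
    (hSerre_f : ∀ i j, i ≠ j →
      f i ^ 3 * f j - (q ^ 2 + 1 + (q ^ 2)⁻¹) • (f i ^ 2 * f j * f i)
        + (q ^ 2 + 1 + (q ^ 2)⁻¹) • (f i * f j * f i ^ 2) - f j * f i ^ 3 = 0)
    (c cb ε : Fin 2 → ℂ)
    (X : Fin 2 → A)
    (hX : ∀ i, X i = c i • (e i * (((K i)⁻¹ : Aˣ) : A)) + cb i • (f i * (((K i)⁻¹ : Aˣ) : A))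
      + ε i • ((((K i)⁻¹ : Aˣ) : A) ^ 2)) :
    ∀ i j, i ≠ j →
      X i ^ 3 * X j - (q ^ 2 + 1 + (q ^ 2)⁻¹) • (X i ^ 2 * X j * X i)
        + (q ^ 2 + 1 + (q ^ 2)⁻¹) • (X i * X j * X i ^ 2) - X j * X i ^ 3
      = (c i * cb i * (q + q⁻¹) ^ 2) • (X i * X j - X j * X i) := by
  intro i j hij
  have hq2 : q ^ 2 - 1 ≠ 0 := sub_ne_zero.mpr (hqroot 2 two_pos)
  have hq2' : q⁻¹ ^ 2 - 1 ≠ 0 := by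
    rw [inv_pow, sub_ne_zero, Ne, inv_eq_one]
    exact hqroot 2 two_pos
  have hqq : q - q⁻¹ ≠ 0 := by
    intro h
    apply hq2
    field_simp at h
    simpa using h
  have hK : (K j : Aˣ) * K i = K i * K j := by
    have h01 : K 0 * K 1 = K 1 * K 0 := Units.ext hKcomm
    fin_cases i <;> fin_cases j <;> first | exact h01 | exact h01.symm | rfl
  have hmn : (((K j)⁻¹ : Aˣ) : A) * (((K i)⁻¹ : Aˣ) : A)
      = (((K i)⁻¹ : Aˣ) : A) * (((K j)⁻¹ : Aˣ) : A) := by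
    rw [← Units.val_mul, ← Units.val_mul, ← mul_inv_rev, ← mul_inv_rev, hK]
  have hei := mul_inv_eq_smul_of_conj _ _ _ (hKeK i)
  have hfi := mul_inv_eq_smul_of_conj _ _ _ (hKfK i)
  have hej := mul_inv_eq_smul_of_conj _ _ _ (hKeK j)
  have hfj := mul_inv_eq_smul_of_conj _ _ _ (hKfK j)
  have hej' := mul_inv_eq_smul_of_conj _ _ _ (hKeK' i j hij)
  have hfj' := mul_inv_eq_smul_of_conj _ _ _ (hKfK' i j hij)
  have hei' := mul_inv_eq_smul_of_conj _ _ _ (hKeK' j i hij.symm)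
  have hfi' := mul_inv_eq_smul_of_conj _ _ _ (hKfK' j i hij.symm)
  have hefi : (((K i)⁻¹ : Aˣ) : A) * ((((K i)⁻¹ : Aˣ) : A) * (e i * f i))
      = (((K i)⁻¹ : Aˣ) : A) * ((((K i)⁻¹ : Aˣ) : A) * (f i * e i))
        + (q - q⁻¹)⁻¹ • (1 - (((K i)⁻¹ : Aˣ) : A) * ((((K i)⁻¹ : Aˣ) : A)
          * ((((K i)⁻¹ : Aˣ) : A) * (((K i)⁻¹ : Aˣ) : A)))) := by
    rw [sub_eq_iff_eq_add'.mp (hef i)]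
    simp only [mul_add, mul_smul_comm, mul_sub, pow_two, Units.inv_mul_cancel_left, Units.inv_mul]
  have hefij := hef' i j hij
  have hefji := hef' j i hij.symm
  have hsx := qSerre_twist q _ hq0 _ _ _ _ hmn hei hei' hej' hej (hSerre_e i j hij)
  have hsy := qSerre_twist q⁻¹ _ (inv_ne_zero hq0) _ _ _ _ hmn hfi (by rwa [inv_inv])
    (by rwa [inv_inv]) hfj (hSerre_f i j hij)
  have hXi := hX i
  rw [hX j]
  clear hX hef hef' hSerre_e hSerre_f hKeK hKfK hKeK' hKfK' hKcomm hqroot hK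
  generalize (((K i)⁻¹ : Aˣ) : A) = m at *
  generalize (((K j)⁻¹ : Aˣ) : A) = n at *
  generalize X i = Y at *
  generalize e i = u at *
  generalize f i = v at *
  generalize e j = u' at *
  generalize f j = v' at *
  have assoc_left {g h l : A} {r : ℂ} (H : g * h = r • (h * l)) (z : A) :
      g * (h * z) = r • (h * (l * z)) := by
    rw [← mul_assoc, H, smul_mul_assoc, mul_assoc]
  have hmn' (z : A) : n * (m * z) = m * (n * z) := by rw [← mul_assoc, hmn, mul_assoc]
  have hxy : (u * m) * (v * m) = q ^ 2 • ((v * m) * (u * m))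
      + (q ^ 2 / (q ^ 2 - 1)) • (1 - m ^ 2 * m ^ 2) := by
    simp only [pow_two (_ : A), mul_assoc (_ : A), smul_mul_assoc, mul_smul_comm, hei, hfi,
      assoc_left hei, assoc_left hfi, hefi, smul_add, smul_smul]
    match_scalars <;> field_simp
  have hyx : (v * m) * (u * m) = q⁻¹ ^ 2 • ((u * m) * (v * m))
      + (q⁻¹ ^ 2 / (q⁻¹ ^ 2 - 1)) • (1 - m ^ 2 * m ^ 2) := by
    rw [hxy]
    match_scalars <;> field_simp <;> grind
  have hxk : (u * m) * m ^ 2 = q ^ 2 • (m ^ 2 * (u * m)) := by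
    simp only [pow_two (_ : A), mul_assoc (_ : A), smul_mul_assoc, mul_smul_comm, hei, assoc_left hei]
    module
  have hyk : (v * m) * m ^ 2 = (q ^ 2)⁻¹ • (m ^ 2 * (v * m)) := by
    simp only [pow_two (_ : A), mul_assoc (_ : A), smul_mul_assoc, mul_smul_comm, hfi, assoc_left hfi]
    match_scalars <;> field_simp
  have h_e := qDolanGrady_of_qSerre q hq0 hq2 (u * m) (v * m) (m ^ 2) (u' * n) (c i) (cb i) (ε i)
    hxy hxk hyk
    (by
      simp only [pow_two (_ : A), mul_assoc (_ : A), mul_smul_comm, hmn, hmn', assoc_left hej']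
      match_scalars <;> field_simp)
    (by
      simp only [mul_assoc (_ : A), mul_smul_comm, smul_mul_assoc, hmn', hfi, hej,
        assoc_left hej', assoc_left hfi', hefji]
      match_scalars <;> field_simp)
    hsx Y hXi
  have h_f := qDolanGrady_of_qSerre q⁻¹ (inv_ne_zero hq0) hq2' (v * m) (u * m) (m ^ 2) (v' * n)
    (cb i) (c i) (ε i) hyx (by rwa [inv_pow]) (by rwa [inv_pow, inv_inv])
    (by
      simp only [pow_two (_ : A), mul_assoc (_ : A), mul_smul_comm, hmn, hmn', assoc_left hfj']
      match_scalars <;> field_simp)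
    (by
      simp only [mul_assoc (_ : A), mul_smul_comm, smul_mul_assoc, hmn', hei, hfj,
        assoc_left hfj', assoc_left hei', hefij]
      match_scalars <;> field_simp)
    (by
      have ht : q⁻¹ ^ 2 + 1 + (q⁻¹ ^ 2)⁻¹ = q ^ 2 + 1 + (q ^ 2)⁻¹ := by field_simp; ring
      rwa [ht])
    Y (by rw [hXi]; abel)
  have h_k := qDolanGrady_of_qCommute q hq0 hq2 (u * m) (v * m) (m ^ 2) (n ^ 2) (c i) (cb i) (ε i)
    hxy hxk hyk
    (by simp only [pow_two (_ : A), mul_assoc (_ : A), hmn, hmn'])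
    (by
      simp only [pow_two (_ : A), mul_assoc (_ : A), smul_mul_assoc, mul_smul_comm,
        hmn', hfi, hfi', assoc_left hfi']
      match_scalars <;> field_simp)
    (by
      simp only [pow_two (_ : A), mul_assoc (_ : A), smul_mul_assoc, mul_smul_comm,
        hmn', hei, hei', assoc_left hei']
      match_scalars <;> field_simp)
    Y hXi
  simp only [mul_add, add_mul, mul_smul_comm, smul_mul_assoc]
  linear_combination (norm := skip) (c j) • h_e + (cb j) • h_f + (ε j) • h_k
  match_scalars <;> field_simp <;> ring
end

section
/- Let c₁, c₂, c̄₁, c̄₂, w₁, w₂ ∈ ℂ and define A₁ = c₁ e₁ K₁ + c̄₁ f₁ K₁ + w₁ K₁² and A₂ = c₂ e₂ K₂ + c̄₂ f₂ K₂ + w₂ K₂². If the constraints w₁ (w₂² + c₂c̄₂/(q + q⁻¹ − 2)) = 0 and w₂ (w₁² + c₁c̄₁/(q + q⁻¹ − 2)) = 0 hold, then for both (i,j) = (1,2) and (i,j) = (2,1) the elements satisfy the generalized q-Onsager relation of a simply-linked pair: A_i²A_j − (q + q⁻¹) A_iA_jA_i + A_jA_i² = c_i c̄_i A_j. -/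
section OnsagerRelations

variable {A : Type*} [Ring A] [Algebra ℂ A]

/-- A relation between products of two factors, extended by an arbitrary right factor. -/
lemma mul_mul_of_mul_eq_smul {a b c d : A} {r : ℂ} (h : a * b = r • (c * d)) (x : A) :
    a * (b * x) = r • (c * (d * x)) := by
  rw [← mul_assoc, h, smul_mul_assoc, mul_assoc]

/-- The element `c • X + d • Y + w • Z`, with `X`, `Y`, `Z` satisfying q-oscillator-like
relations, satisfies the q-Onsager relation with `P` when `X`, `P` satisfy the q-Serre relation and
`Y`, `Z` q-commute with `P`. -/
lemma onsager_of_serre {q : ℂ} (hq0 : q ≠ 0) (hq2 : q ^ 2 - 1 ≠ 0) {X Y Z P : A}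
    (hZX : Z * X = q ^ 2 • (X * Z)) (hZY : Z * Y = (q ^ 2)⁻¹ • (Y * Z))
    (hYX : Y * X = q ^ 2 • (X * Y) - (q ^ 2 * (q ^ 2 - 1)⁻¹) • (Z * Z - 1))
    (hYP : Y * P = q⁻¹ • (P * Y)) (hZP : Z * P = q⁻¹ • (P * Z))
    (hXP : X * (X * P) = (q + q⁻¹) • (X * (P * X)) - P * (X * X)) (c d w : ℂ) :
    (c • X + d • Y + w • Z) ^ 2 * P
      - (q + q⁻¹) • ((c • X + d • Y + w • Z) * P * (c • X + d • Y + w • Z))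
      + P * (c • X + d • Y + w • Z) ^ 2 = (c * d) • P := by
  simp only [pow_two (c • X + d • Y + w • Z), mul_add, add_mul, smul_mul_assoc, mul_smul_comm,
    mul_assoc, hZX, hZY, hYX, hYP, hZP, hXP,
    mul_mul_of_mul_eq_smul hYP, mul_mul_of_mul_eq_smul hZP,
    mul_sub, sub_mul, mul_one, one_mul]
  match_scalars <;> field_simp <;> ring

/-- The same element and an element `T` with which `X`, `Y`, `Z` all q-commute satisfy the
q-Onsager relation up to a term in `Z * (Z * T)`. -/
lemma onsager_of_qcommute {q : ℂ} (hq0 : q ≠ 0) (hq2 : q ^ 2 - 1 ≠ 0) {X Y Z T : A}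
    (hZX : Z * X = q ^ 2 • (X * Z)) (hZY : Z * Y = (q ^ 2)⁻¹ • (Y * Z))
    (hYX : Y * X = q ^ 2 • (X * Y) - (q ^ 2 * (q ^ 2 - 1)⁻¹) • (Z * Z - 1))
    (hTX : T * X = q⁻¹ • (X * T)) (hTY : T * Y = q • (Y * T)) (hTZ : T * Z = Z * T)
    (c d w : ℂ) :
    (c • X + d • Y + w • Z) ^ 2 * T
      - (q + q⁻¹) • ((c • X + d • Y + w • Z) * T * (c • X + d • Y + w • Z))
      + T * (c • X + d • Y + w • Z) ^ 2
      = (c * d) • T - (c * d + w ^ 2 * (q + q⁻¹ - 2)) • (Z * (Z * T)) := by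
  have hYX' (x : A) : Y * (X * x) = q ^ 2 • (X * (Y * x))
      - (q ^ 2 * (q ^ 2 - 1)⁻¹) • (Z * (Z * x) - x) := by
    rw [← mul_assoc, hYX]
    simp only [sub_mul, smul_mul_assoc, mul_assoc, one_mul]
  have hTZ' (x : A) : T * (Z * x) = Z * (T * x) := by
    rw [← mul_assoc, hTZ, mul_assoc]
  simp only [pow_two (c • X + d • Y + w • Z), mul_add, add_mul, smul_mul_assoc, mul_smul_comm,
    mul_assoc, hZX, hZY, hYX, hTX, hTY, hTZ, hYX', hTZ', mul_mul_of_mul_eq_smul hZX,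
    mul_mul_of_mul_eq_smul hZY, mul_mul_of_mul_eq_smul hTX, mul_mul_of_mul_eq_smul hTY,
    mul_sub, sub_mul, mul_one, one_mul]
  match_scalars <;> field_simp <;> ring

/-- One of the two q-Onsager relations of a simply-linked pair. -/
lemma onsager_relation {s q : ℂ} (hs0 : s ≠ 0) (hs4 : s ^ 4 ≠ 1) (hq : q = s ^ 2)
    {e₁ e₂ f₁ f₂ K₁ K₂ L₁ : A} (hLK : L₁ * K₁ = 1)
    (hKcomm : K₁ * K₂ = K₂ * K₁)
    (hK1e1 : K₁ * e₁ = q • (e₁ * K₁)) (hK1f1 : K₁ * f₁ = q⁻¹ • (f₁ * K₁))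
    (hK1e2 : K₁ * e₂ = s⁻¹ • (e₂ * K₁)) (hK1f2 : K₁ * f₂ = s • (f₂ * K₁))
    (hK2e1 : K₂ * e₁ = s⁻¹ • (e₁ * K₂)) (hK2f1 : K₂ * f₁ = s • (f₁ * K₂))
    (hef1 : e₁ * f₁ - f₁ * e₁ = (q - q⁻¹)⁻¹ • (K₁ ^ 2 - L₁ ^ 2))
    (hef12 : e₁ * f₂ = f₂ * e₁) (hef21 : e₂ * f₁ = f₁ * e₂)
    (hSe12 : e₁ ^ 2 * e₂ - (q + q⁻¹) • (e₁ * e₂ * e₁) + e₂ * e₁ ^ 2 = 0)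
    (hSf12 : f₁ ^ 2 * f₂ - (q + q⁻¹) • (f₁ * f₂ * f₁) + f₂ * f₁ ^ 2 = 0)
    (c₁ c₂ d₁ d₂ w₁ w₂ : ℂ)
    (hcon : w₂ * (c₁ * d₁ + w₁ ^ 2 * (q + q⁻¹ - 2)) = 0)
    {A₁ A₂ : A}
    (hA1 : A₁ = c₁ • (e₁ * K₁) + d₁ • (f₁ * K₁) + w₁ • K₁ ^ 2)
    (hA2 : A₂ = c₂ • (e₂ * K₂) + d₂ • (f₂ * K₂) + w₂ • K₂ ^ 2) :
    A₁ ^ 2 * A₂ - (q + q⁻¹) • (A₁ * A₂ * A₁) + A₂ * A₁ ^ 2 = (c₁ * d₁) • A₂ := by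
  have hq0 : q ≠ 0 := hq ▸ pow_ne_zero 2 hs0
  have hq2 : q ^ 2 - 1 ≠ 0 := by
    rw [hq, ← pow_mul]
    exact sub_ne_zero.mpr hs4
  have hqi2 : q⁻¹ ^ 2 - 1 ≠ 0 := by
    rw [show q⁻¹ ^ 2 - 1 = -(q ^ 2 - 1) / q ^ 2 by field_simp; ring]
    exact div_ne_zero (neg_ne_zero.mpr hq2) (pow_ne_zero 2 hq0)
  have hqq : (q - q⁻¹)⁻¹ = q * (q ^ 2 - 1)⁻¹ := by
    rw [show q - q⁻¹ = (q ^ 2 - 1) * q⁻¹ by field_simp, mul_inv, inv_inv, mul_comm]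
  have hqi : (q⁻¹ ^ 2 - 1)⁻¹ = -(q ^ 2 * (q ^ 2 - 1)⁻¹) := by
    rw [inv_eq_iff_eq_inv, inv_neg, mul_inv, inv_inv]
    field_simp
    ring
  have hK2K1 (x : A) : K₂ * (K₁ * x) = K₁ * (K₂ * x) := by
    rw [← mul_assoc, ← hKcomm, mul_assoc]
  have K1e1 := mul_mul_of_mul_eq_smul hK1e1
  have K1f1 := mul_mul_of_mul_eq_smul hK1f1
  have K1e2 := mul_mul_of_mul_eq_smul hK1e2
  have K1f2 := mul_mul_of_mul_eq_smul hK1f2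
  have K2e1 := mul_mul_of_mul_eq_smul hK2e1
  have K2f1 := mul_mul_of_mul_eq_smul hK2f1
  have hfe : f₁ * e₁ = e₁ * f₁ - (q - q⁻¹)⁻¹ • (K₁ * K₁ - L₁ * L₁) := by
    rw [← pow_two, ← pow_two, ← hef1, sub_sub_cancel]
  have hfe' (x : A) : f₁ * (e₁ * x) = e₁ * (f₁ * x)
      - (q - q⁻¹)⁻¹ • (K₁ * (K₁ * x) - L₁ * (L₁ * x)) := by
    rw [← mul_assoc, hfe]
    simp only [sub_mul, smul_mul_assoc, mul_assoc]
  have hLKx (x : A) : L₁ * (K₁ * x) = x := by rw [← mul_assoc, hLK, one_mul]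
  have hef12' (x : A) : e₁ * (f₂ * x) = f₂ * (e₁ * x) := by
    rw [← mul_assoc, hef12, mul_assoc]
  have hef21' (x : A) : e₂ * (f₁ * x) = f₁ * (e₂ * x) := by
    rw [← mul_assoc, hef21, mul_assoc]
  have hSe (x : A) : e₁ * (e₁ * (e₂ * x))
      = (q + q⁻¹) • (e₁ * (e₂ * (e₁ * x))) - e₂ * (e₁ * (e₁ * x)) := by
    have h := congrArg (· * x) hSe12
    simp only [pow_two, add_mul, sub_mul, smul_mul_assoc, mul_assoc, zero_mul] at h
    rw [← sub_eq_zero, ← h]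
    abel
  have hSf (x : A) : f₁ * (f₁ * (f₂ * x))
      = (q + q⁻¹) • (f₁ * (f₂ * (f₁ * x))) - f₂ * (f₁ * (f₁ * x)) := by
    have h := congrArg (· * x) hSf12
    simp only [pow_two, add_mul, sub_mul, smul_mul_assoc, mul_assoc, zero_mul] at h
    rw [← sub_eq_zero, ← h]
    abel
  have hZX : K₁ ^ 2 * (e₁ * K₁) = q ^ 2 • (e₁ * K₁ * K₁ ^ 2) := by
    simp only [pow_two K₁, mul_assoc, K1e1, mul_smul_comm]
    module
  have hZY : K₁ ^ 2 * (f₁ * K₁) = (q ^ 2)⁻¹ • (f₁ * K₁ * K₁ ^ 2) := by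
    simp only [pow_two K₁, mul_assoc, K1f1, mul_smul_comm]
    match_scalars
    field_simp
  have hYX : f₁ * K₁ * (e₁ * K₁) = q ^ 2 • (e₁ * K₁ * (f₁ * K₁))
      - (q ^ 2 * (q ^ 2 - 1)⁻¹) • (K₁ ^ 2 * K₁ ^ 2 - 1) := by
    simp only [pow_two K₁, mul_assoc, K1e1, K1f1, mul_smul_comm, hfe', hLKx, hLK, hqq]
    match_scalars <;> field_simp
  have hXY : e₁ * K₁ * (f₁ * K₁) = q⁻¹ ^ 2 • (f₁ * K₁ * (e₁ * K₁))
      - (q⁻¹ ^ 2 * (q⁻¹ ^ 2 - 1)⁻¹) • (K₁ ^ 2 * K₁ ^ 2 - 1) := by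
    rw [hYX, hqi]
    match_scalars <;> field_simp <;> ring
  have hP := onsager_of_serre (P := e₂ * K₂) hq0 hq2 hZX hZY hYX
    (by
      simp only [mul_assoc, K1e2, K2f1, mul_smul_comm, hef21', hKcomm]
      match_scalars
      rw [hq]
      field_simp)
    (by
      simp only [pow_two K₁, mul_assoc, K1e2, mul_smul_comm, hK2K1, ← hKcomm]
      match_scalars
      rw [hq]
      field_simp)
    (by
      simp only [mul_assoc, K1e1, K1e2, K2e1, mul_smul_comm, hSe, hK2K1, ← hKcomm]
      match_scalars <;> rw [hq] <;> field_simp) c₁ d₁ w₁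
  have hR := onsager_of_serre (P := f₂ * K₂) (inv_ne_zero hq0) hqi2
    (X := f₁ * K₁) (Y := e₁ * K₁) (Z := K₁ ^ 2)
    (by rw [hZY, inv_pow]) (by rw [hZX, inv_pow, inv_inv]) hXY
    (by
      simp only [mul_assoc, K1f2, K2e1, mul_smul_comm, hef12', hKcomm]
      match_scalars
      rw [hq]
      field_simp)
    (by
      simp only [pow_two K₁, mul_assoc, K1f2, mul_smul_comm, hK2K1, ← hKcomm]
      match_scalars
      rw [hq]
      field_simp)
    (by
      simp only [mul_assoc, K1f1, K1f2, K2f1, mul_smul_comm, hSf, hK2K1, ← hKcomm]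
      match_scalars <;> rw [hq] <;> field_simp; ring) d₁ c₁ w₁
  have hT := onsager_of_qcommute (T := K₂ ^ 2) hq0 hq2 hZX hZY hYX
    (by
      simp only [pow_two K₂, mul_assoc, K2e1, mul_smul_comm, hK2K1, ← hKcomm]
      match_scalars
      rw [hq]
      field_simp)
    (by
      simp only [pow_two K₂, mul_assoc, K2f1, mul_smul_comm, hK2K1, ← hKcomm]
      match_scalars
      rw [hq]
      ring)
    (by simp only [pow_two, mul_assoc, hK2K1, ← hKcomm]) c₁ d₁ w₁
  rw [inv_inv, add_comm (q⁻¹) q, add_comm (d₁ • (f₁ * K₁)), mul_comm d₁] at hR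
  rw [← hA1] at hP hR hT
  have hsplit : A₁ ^ 2 * A₂ - (q + q⁻¹) • (A₁ * A₂ * A₁) + A₂ * A₁ ^ 2
      = c₂ • (A₁ ^ 2 * (e₂ * K₂) - (q + q⁻¹) • (A₁ * (e₂ * K₂) * A₁) + e₂ * K₂ * A₁ ^ 2)
      + d₂ • (A₁ ^ 2 * (f₂ * K₂) - (q + q⁻¹) • (A₁ * (f₂ * K₂) * A₁) + f₂ * K₂ * A₁ ^ 2)
      + w₂ • (A₁ ^ 2 * K₂ ^ 2 - (q + q⁻¹) • (A₁ * K₂ ^ 2 * A₁) + K₂ ^ 2 * A₁ ^ 2) := by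
    rw [hA2]
    simp only [mul_add, add_mul, mul_smul_comm, smul_mul_assoc]
    module
  rw [hsplit, hP, hR, hT, hA2]
  rw [smul_sub, smul_smul w₂ (_ + _), hcon]
  module

lemma mul_eq_smul_of_conj {K : Aˣ} {x : A} {r : ℂ}
    (h : (K : A) * x * ((K⁻¹ : Aˣ) : A) = r • x) : (K : A) * x = r • (x * (K : A)) := by
  rw [← smul_mul_assoc, ← h, Units.inv_mul_cancel_right]

end OnsagerRelations

/-- For a simply-linked pair of nodes of a quantum affine algebra,
`A_i = c_i e_i K_i + c̄_i f_i K_i + w_i K_i²` satisfy the simply-linked generalized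
q-Onsager relations, provided the constraints on `w₁, w₂` hold. -/
theorem stmt_2 (s : ℂ) (hs0 : s ≠ 0) (hsroot : ∀ n : ℕ, 0 < n → s ^ n ≠ 1)
    (q : ℂ) (hq : q = s ^ 2)
    (A : Type*) [Ring A] [Algebra ℂ A]
    (e₁ e₂ f₁ f₂ : A) (K₁ K₂ : Aˣ)
    (hKcomm : (K₁ : A) * (K₂ : A) = (K₂ : A) * (K₁ : A))
    (hK1e1 : (K₁ : A) * e₁ * ((K₁⁻¹ : Aˣ) : A) = q • e₁)
    (hK1f1 : (K₁ : A) * f₁ * ((K₁⁻¹ : Aˣ) : A) = q⁻¹ • f₁)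
    (hK2e2 : (K₂ : A) * e₂ * ((K₂⁻¹ : Aˣ) : A) = q • e₂)
    (hK2f2 : (K₂ : A) * f₂ * ((K₂⁻¹ : Aˣ) : A) = q⁻¹ • f₂)
    (hK1e2 : (K₁ : A) * e₂ * ((K₁⁻¹ : Aˣ) : A) = s⁻¹ • e₂)
    (hK1f2 : (K₁ : A) * f₂ * ((K₁⁻¹ : Aˣ) : A) = s • f₂)
    (hK2e1 : (K₂ : A) * e₁ * ((K₂⁻¹ : Aˣ) : A) = s⁻¹ • e₁)
    (hK2f1 : (K₂ : A) * f₁ * ((K₂⁻¹ : Aˣ) : A) = s • f₁)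
    (hef1 : e₁ * f₁ - f₁ * e₁ = (q - q⁻¹)⁻¹ • ((K₁ : A) ^ 2 - ((K₁⁻¹ : Aˣ) : A) ^ 2))
    (hef2 : e₂ * f₂ - f₂ * e₂ = (q - q⁻¹)⁻¹ • ((K₂ : A) ^ 2 - ((K₂⁻¹ : Aˣ) : A) ^ 2))
    (hef12 : e₁ * f₂ = f₂ * e₁) (hef21 : e₂ * f₁ = f₁ * e₂)
    (hSe12 : e₁ ^ 2 * e₂ - (q + q⁻¹) • (e₁ * e₂ * e₁) + e₂ * e₁ ^ 2 = 0)
    (hSe21 : e₂ ^ 2 * e₁ - (q + q⁻¹) • (e₂ * e₁ * e₂) + e₁ * e₂ ^ 2 = 0)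
    (hSf12 : f₁ ^ 2 * f₂ - (q + q⁻¹) • (f₁ * f₂ * f₁) + f₂ * f₁ ^ 2 = 0)
    (hSf21 : f₂ ^ 2 * f₁ - (q + q⁻¹) • (f₂ * f₁ * f₂) + f₁ * f₂ ^ 2 = 0)
    (c₁ c₂ cb₁ cb₂ w₁ w₂ : ℂ)
    (hcon1 : w₁ * (w₂ ^ 2 + c₂ * cb₂ / (q + q⁻¹ - 2)) = 0)
    (hcon2 : w₂ * (w₁ ^ 2 + c₁ * cb₁ / (q + q⁻¹ - 2)) = 0)
    (A₁ A₂ : A)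
    (hA1 : A₁ = c₁ • (e₁ * (K₁ : A)) + cb₁ • (f₁ * (K₁ : A)) + w₁ • ((K₁ : A) ^ 2))
    (hA2 : A₂ = c₂ • (e₂ * (K₂ : A)) + cb₂ • (f₂ * (K₂ : A)) + w₂ • ((K₂ : A) ^ 2)) :
    A₁ ^ 2 * A₂ - (q + q⁻¹) • (A₁ * A₂ * A₁) + A₂ * A₁ ^ 2 = (c₁ * cb₁) • A₂
    ∧ A₂ ^ 2 * A₁ - (q + q⁻¹) • (A₂ * A₁ * A₂) + A₁ * A₂ ^ 2 = (c₂ * cb₂) • A₁ := by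
  have hs4 : s ^ 4 ≠ 1 := hsroot 4 (by norm_num)
  have hq2 : q + q⁻¹ - 2 ≠ 0 := by
    have hq0 : q ≠ 0 := hq ▸ pow_ne_zero 2 hs0
    rw [show q + q⁻¹ - 2 = (q - 1) ^ 2 / q by field_simp; ring]
    refine div_ne_zero (pow_ne_zero 2 (sub_ne_zero.mpr ?_)) hq0
    exact hq ▸ hsroot 2 (by norm_num)
  have clear_denom {c d v w : ℂ} (h : w * (v ^ 2 + c * d / (q + q⁻¹ - 2)) = 0) :
      w * (c * d + v ^ 2 * (q + q⁻¹ - 2)) = 0 := by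
    rw [show c * d + v ^ 2 * (q + q⁻¹ - 2)
      = (v ^ 2 + c * d / (q + q⁻¹ - 2)) * (q + q⁻¹ - 2) by
        rw [add_mul, div_mul_cancel₀ _ hq2, add_comm], ← mul_assoc, h, zero_mul]
  exact ⟨onsager_relation hs0 hs4 hq K₁.inv_mul hKcomm
      (mul_eq_smul_of_conj hK1e1) (mul_eq_smul_of_conj hK1f1)
      (mul_eq_smul_of_conj hK1e2) (mul_eq_smul_of_conj hK1f2)
      (mul_eq_smul_of_conj hK2e1) (mul_eq_smul_of_conj hK2f1)
      hef1 hef12 hef21 hSe12 hSf12 c₁ c₂ cb₁ cb₂ w₁ w₂ (clear_denom hcon2) hA1 hA2,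
    onsager_relation hs0 hs4 hq K₂.inv_mul hKcomm.symm
      (mul_eq_smul_of_conj hK2e2) (mul_eq_smul_of_conj hK2f2)
      (mul_eq_smul_of_conj hK2e1) (mul_eq_smul_of_conj hK2f1)
      (mul_eq_smul_of_conj hK1e2) (mul_eq_smul_of_conj hK1f2)
      hef2 hef21 hef12 hSe21 hSf21 c₂ c₁ cb₂ cb₁ w₂ w₁ (clear_denom hcon1) hA2 hA1⟩
end

section
/- Let c₁, c₂, c̄₁, c̄₂, w₁, w₂ ∈ ℂ and define A₁ = c₁ e₁ K₁ + c̄₁ f₁ K₁ + w₁ K₁² and A₂ = c₂ e₂ K₂ + c̄₂ f₂ K₂ + w₂ K₂². If the constraint w₂ (w₁² + c₁c̄₁/(q² + q⁻² − 2)) = 0 holds, then the elements satisfy the generalized q-Onsager relations of a doubly-linked pair: A₁²A₂ − (q² + q⁻²) A₁A₂A₁ + A₂A₁² = c₁c̄₁ A₂, and A₂³A₁ − [3]_q A₂²A₁A₂ + [3]_q A₂A₁A₂² − A₁A₂³ = c₂c̄₂ (q + q⁻¹)² (A₂A₁ − A₁A₂). -/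
/-- `E = eK`, `F = fK` and `k = K²` for a copy of quantum `sl₂` with parameter `p`. -/
structure IsQuantumTriple {A : Type*} [Ring A] [Algebra ℂ A] (p : ℂ) (E F k : A) : Prop where
  k_mul_E : k * E = p ^ 2 • (E * k)
  k_mul_F : k * F = (p ^ 2)⁻¹ • (F * k)
  E_mul_F : E * F = (p ^ 2)⁻¹ • (F * E) + (p ^ 2 - 1)⁻¹ • (k * k - 1)

theorem mul_mul_of_mul_eq {A : Type*} [Semigroup A] {x y z : A} (h : x * y = z) (t : A) :
    x * (y * t) = z * t := by
  rw [← mul_assoc, h]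

/-- A `q`-commutation relation `x y x⁻¹ = r y` without the inverse. -/
theorem mul_eq_smul_mul_of_conj {A : Type*} [Ring A] [Algebra ℂ A] {x : Aˣ} {y : A} {r : ℂ}
    (h : (x : A) * y * ((x⁻¹ : Aˣ) : A) = r • y) : (x : A) * y = r • (y * (x : A)) := by
  rw [← smul_mul_assoc, ← h, Units.inv_mul_cancel_right]

namespace IsQuantumTriple

theorem quadratic_relation_raising {A : Type*} [Ring A] [Algebra ℂ A] {p : ℂ} {E F k : A}
    (h : IsQuantumTriple p E F k) (hp : p ≠ 0) (hp2 : p ^ 2 - 1 ≠ 0) {X : A}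
    (hkX : k * X = p⁻¹ • (X * k)) (hXF : X * F = p • (F * X))
    (hS : E * (E * X) = (p + p⁻¹) • (E * (X * E)) - X * (E * E))
    (c d w : ℂ) :
    (c • E + d • F + w • k) ^ 2 * X
      - (p + p⁻¹) • ((c • E + d • F + w • k) * X * (c • E + d • F + w • k))
      + X * (c • E + d • F + w • k) ^ 2 = (c * d) • X := by
  obtain ⟨hkE, hkF, hEF⟩ := h
  simp only [pow_succ (_ + _ : A), pow_zero, mul_add, add_mul, mul_sub, sub_mul, smul_mul_assoc,
    mul_smul_comm, mul_assoc, smul_add, smul_sub, smul_smul, mul_one, one_mul,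
    hkE, hkF, hEF, hkX, hXF, hS,
    mul_mul_of_mul_eq hEF, mul_mul_of_mul_eq hkX, mul_mul_of_mul_eq hXF]
  match_scalars <;> field_simp <;> ring

theorem quadratic_relation_lowering {A : Type*} [Ring A] [Algebra ℂ A] {p : ℂ} {E F k : A}
    (h : IsQuantumTriple p E F k) (hp : p ≠ 0) (hp2 : p ^ 2 - 1 ≠ 0) {X : A}
    (hkX : k * X = p • (X * k)) (hEX : E * X = p • (X * E))
    (hS : F * (F * X) = (p + p⁻¹) • (F * (X * F)) - X * (F * F))
    (c d w : ℂ) :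
    (c • E + d • F + w • k) ^ 2 * X
      - (p + p⁻¹) • ((c • E + d • F + w • k) * X * (c • E + d • F + w • k))
      + X * (c • E + d • F + w • k) ^ 2 = (c * d) • X := by
  obtain ⟨hkE, hkF, hEF⟩ := h
  simp only [pow_succ (_ + _ : A), pow_zero, mul_add, add_mul, mul_sub, sub_mul, smul_mul_assoc,
    mul_smul_comm, mul_assoc, smul_add, smul_sub, smul_smul, mul_one, one_mul,
    hkE, hkF, hEF, hkX, hEX, hS,
    mul_mul_of_mul_eq hkX, mul_mul_of_mul_eq hEX]
  match_scalars <;> field_simp <;> ring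

theorem quadratic_relation_cartan {A : Type*} [Ring A] [Algebra ℂ A] {p : ℂ} {E F k : A}
    (h : IsQuantumTriple p E F k) (hp : p ≠ 0) (hp2 : p ^ 2 - 1 ≠ 0) {X : A}
    (hkX : k * X = X * k) (hEX : E * X = p • (X * E))
    (hFX : F * X = p⁻¹ • (X * F))
    (c d w : ℂ) :
    (c • E + d • F + w • k) ^ 2 * X
      - (p + p⁻¹) • ((c • E + d • F + w • k) * X * (c • E + d • F + w • k))
      + X * (c • E + d • F + w • k) ^ 2 = (c * d) • X +
        ((2 - p - p⁻¹) * w ^ 2 - c * d) • (X * (k * k)) := by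
  obtain ⟨hkE, hkF, hEF⟩ := h
  simp only [pow_succ (_ + _ : A), pow_zero, mul_add, add_mul, mul_sub, sub_mul, smul_mul_assoc,
    mul_smul_comm, mul_assoc, smul_add, smul_sub, smul_smul, mul_one, one_mul,
    hkE, hkF, hEF, hkX, hEX, hFX,
    mul_mul_of_mul_eq hkX, mul_mul_of_mul_eq hEX, mul_mul_of_mul_eq hFX]
  match_scalars <;> field_simp <;> ring

theorem cubic_relation_raising {A : Type*} [Ring A] [Algebra ℂ A] {p : ℂ} {E F k : A}
    (h : IsQuantumTriple p E F k) (hp : p ≠ 0) (hp2 : p ^ 2 - 1 ≠ 0) {X : A}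
    (hkX : k * X = (p ^ 2)⁻¹ • (X * k)) (hXF : X * F = p ^ 2 • (F * X))
    (hS : E * (E * (E * X)) = (p ^ 2 + 1 + (p ^ 2)⁻¹) • (E * (E * (X * E)))
      - (p ^ 2 + 1 + (p ^ 2)⁻¹) • (E * (X * (E * E))) + X * (E * (E * E)))
    (c d w : ℂ) :
    (c • E + d • F + w • k) ^ 3 * X
      - (p ^ 2 + 1 + (p ^ 2)⁻¹) • ((c • E + d • F + w • k) ^ 2 * X * (c • E + d • F + w • k))
      + (p ^ 2 + 1 + (p ^ 2)⁻¹) • ((c • E + d • F + w • k) * X * (c • E + d • F + w • k) ^ 2)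
      - X * (c • E + d • F + w • k) ^ 3
      = (c * d * (p + p⁻¹) ^ 2) •
        ((c • E + d • F + w • k) * X - X * (c • E + d • F + w • k)) := by
  obtain ⟨hkE, hkF, hEF⟩ := h
  simp only [pow_succ (_ + _ : A), pow_zero, mul_add, add_mul, mul_sub, sub_mul, smul_mul_assoc,
    mul_smul_comm, mul_assoc, smul_add, smul_sub, smul_smul, mul_one, one_mul,
    hkE, hkF, hEF, hkX, hXF, hS,
    mul_mul_of_mul_eq hkE, mul_mul_of_mul_eq hkF, mul_mul_of_mul_eq hEF, mul_mul_of_mul_eq hkX,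
    mul_mul_of_mul_eq hXF]
  match_scalars <;> field_simp <;> ring

theorem cubic_relation_lowering {A : Type*} [Ring A] [Algebra ℂ A] {p : ℂ} {E F k : A}
    (h : IsQuantumTriple p E F k) (hp : p ≠ 0) (hp2 : p ^ 2 - 1 ≠ 0) {X : A}
    (hkX : k * X = p ^ 2 • (X * k)) (hEX : E * X = p ^ 2 • (X * E))
    (hS : F * (F * (F * X)) = (p ^ 2 + 1 + (p ^ 2)⁻¹) • (F * (F * (X * F)))
      - (p ^ 2 + 1 + (p ^ 2)⁻¹) • (F * (X * (F * F))) + X * (F * (F * F)))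
    (c d w : ℂ) :
    (c • E + d • F + w • k) ^ 3 * X
      - (p ^ 2 + 1 + (p ^ 2)⁻¹) • ((c • E + d • F + w • k) ^ 2 * X * (c • E + d • F + w • k))
      + (p ^ 2 + 1 + (p ^ 2)⁻¹) • ((c • E + d • F + w • k) * X * (c • E + d • F + w • k) ^ 2)
      - X * (c • E + d • F + w • k) ^ 3
      = (c * d * (p + p⁻¹) ^ 2) •
        ((c • E + d • F + w • k) * X - X * (c • E + d • F + w • k)) := by
  obtain ⟨hkE, hkF, hEF⟩ := h
  simp only [pow_succ (_ + _ : A), pow_zero, mul_add, add_mul, mul_sub, sub_mul, smul_mul_assoc,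
    mul_smul_comm, mul_assoc, smul_add, smul_sub, smul_smul, mul_one, one_mul,
    hkE, hkF, hEF, hkX, hEX, hS,
    mul_mul_of_mul_eq hkE, mul_mul_of_mul_eq hkF, mul_mul_of_mul_eq hEF, mul_mul_of_mul_eq hkX,
    mul_mul_of_mul_eq hEX]
  match_scalars <;> field_simp <;> ring

theorem cubic_relation_cartan {A : Type*} [Ring A] [Algebra ℂ A] {p : ℂ} {E F k : A}
    (h : IsQuantumTriple p E F k) (hp : p ≠ 0) (hp2 : p ^ 2 - 1 ≠ 0) {X : A}
    (hkX : k * X = X * k) (hEX : E * X = p ^ 2 • (X * E))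
    (hFX : F * X = (p ^ 2)⁻¹ • (X * F))
    (c d w : ℂ) :
    (c • E + d • F + w • k) ^ 3 * X
      - (p ^ 2 + 1 + (p ^ 2)⁻¹) • ((c • E + d • F + w • k) ^ 2 * X * (c • E + d • F + w • k))
      + (p ^ 2 + 1 + (p ^ 2)⁻¹) • ((c • E + d • F + w • k) * X * (c • E + d • F + w • k) ^ 2)
      - X * (c • E + d • F + w • k) ^ 3
      = (c * d * (p + p⁻¹) ^ 2) •
        ((c • E + d • F + w • k) * X - X * (c • E + d • F + w • k)) := by
  obtain ⟨hkE, hkF, hEF⟩ := h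
  simp only [pow_succ (_ + _ : A), pow_zero, mul_add, add_mul, mul_sub, sub_mul, smul_mul_assoc,
    mul_smul_comm, mul_assoc, smul_add, smul_sub, smul_smul, mul_one, one_mul,
    hkE, hkF, hEF, hkX, hEX, hFX,
    mul_mul_of_mul_eq hkE, mul_mul_of_mul_eq hkF, mul_mul_of_mul_eq hEF, mul_mul_of_mul_eq hkX,
    mul_mul_of_mul_eq hEX, mul_mul_of_mul_eq hFX]
  match_scalars <;> field_simp <;> ring

end IsQuantumTriple

theorem IsQuantumTriple.of_generators {A : Type*} [Ring A] [Algebra ℂ A] {p : ℂ} (hp : p ≠ 0)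
    (hp2 : p ^ 2 - 1 ≠ 0) {e f : A} {K : Aˣ} (hKe : (K : A) * e = p • (e * (K : A)))
    (hKf : (K : A) * f = p⁻¹ • (f * (K : A)))
    (hef : e * f - f * e = (p - p⁻¹)⁻¹ • ((K : A) ^ 2 - ((K⁻¹ : Aˣ) : A) ^ 2)) :
    IsQuantumTriple p (e * (K : A)) (f * (K : A)) ((K : A) ^ 2) where
  k_mul_E := by
    simp only [pow_two (K : A), mul_assoc, mul_mul_of_mul_eq hKe, mul_smul_comm,
      smul_mul_assoc, smul_smul, pow_two p]
  k_mul_F := by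
    simp only [pow_two (K : A), mul_assoc, mul_mul_of_mul_eq hKf, mul_smul_comm,
      smul_mul_assoc, smul_smul, pow_two p, mul_inv]
  E_mul_F := by
    have hK : ((K⁻¹ : Aˣ) : A) ^ 2 * ((K : A) * (K : A)) = 1 := by
      rw [← pow_two, ← Units.val_pow_eq_pow_val, ← Units.val_pow_eq_pow_val, inv_pow,
        Units.inv_mul]
    have h := congrArg (· * ((K : A) * (K : A))) hef
    simp only [sub_mul, smul_mul_assoc, hK] at h
    simp only [pow_two (K : A), mul_assoc, mul_mul_of_mul_eq hKe, mul_mul_of_mul_eq hKf,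
      mul_smul_comm, smul_mul_assoc] at h ⊢
    have hp3 : p - p⁻¹ ≠ 0 := by
      intro h0
      apply hp2
      field_simp at h0
      simpa using h0
    have hs : p⁻¹ * (p - p⁻¹)⁻¹ = (p ^ 2 - 1)⁻¹ := by
      rw [← mul_inv]
      congr 1
      field_simp
    rw [← hs]
    linear_combination (norm := skip) p⁻¹ • h
    match_scalars <;> field_simp <;> ring

section GeneratorsTimesCartan

variable {A : Type*} [Ring A] [Algebra ℂ A] {K L x y : A} {r s b : ℂ}

theorem sq_mul_of_qcomm (hKx : K * x = r • (x * K)) (hKL : K * L = L * K) :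
    K ^ 2 * (x * L) = r ^ 2 • (x * L * K ^ 2) := by
  simp only [pow_two, mul_assoc, mul_mul_of_mul_eq hKx, hKL, mul_mul_of_mul_eq hKL,
    mul_smul_comm, smul_mul_assoc, smul_smul]

theorem mul_sq_of_qcomm (hr : r ≠ 0) (hKx : K * x = r • (x * K)) (hKL : K * L = L * K) :
    x * L * K ^ 2 = (r ^ 2)⁻¹ • (K ^ 2 * (x * L)) := by
  rw [sq_mul_of_qcomm hKx hKL, inv_smul_smul₀ (pow_ne_zero 2 hr)]

theorem mul_mul_of_commute (hr : r ≠ 0) (hxy : x * y = y * x) (hKy : K * y = r • (y * K))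
    (hLx : L * x = r⁻¹ • (x * L)) (hKL : K * L = L * K) :
    x * K * (y * L) = r ^ 2 • (y * L * (x * K)) := by
  simp only [mul_assoc, mul_mul_of_mul_eq hKy, mul_mul_of_mul_eq hLx, mul_mul_of_mul_eq hxy, hKL,
    mul_smul_comm, smul_mul_assoc, smul_smul]
  match_scalars
  field_simp

theorem quadratic_serre_mul_cartan (hKx : K * x = s • (x * K)) (hKy : K * y = r • (y * K))
    (hLx : L * x = r • (x * L)) (hKL : K * L = L * K)
    (hS : x ^ 2 * y - b • (x * y * x) + y * x ^ 2 = 0) :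
    x * K * (x * K * (y * L)) =
      b • (x * K * (y * L * (x * K))) - y * L * (x * K * (x * K)) := by
  have h := congrArg (· * (K * (K * L))) hS
  simp only [pow_succ, pow_zero, one_mul, zero_mul, sub_mul, add_mul, mul_assoc, mul_smul_comm,
    smul_mul_assoc, smul_smul, hKL, mul_mul_of_mul_eq hKL, mul_mul_of_mul_eq hKx,
    mul_mul_of_mul_eq hKy, mul_mul_of_mul_eq hLx] at h ⊢
  linear_combination (norm := module) (s * r ^ 2) • h

theorem cubic_serre_mul_cartan (hKx : K * x = s • (x * K)) (hKy : K * y = r • (y * K))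
    (hLx : L * x = r • (x * L)) (hKL : K * L = L * K)
    (hS : x ^ 3 * y - b • (x ^ 2 * y * x) + b • (x * y * x ^ 2) - y * x ^ 3 = 0) :
    x * K * (x * K * (x * K * (y * L))) =
      b • (x * K * (x * K * (y * L * (x * K)))) - b • (x * K * (y * L * (x * K * (x * K))))
        + y * L * (x * K * (x * K * (x * K))) := by
  have h := congrArg (· * (K * (K * (K * L)))) hS
  simp only [pow_succ, pow_zero, one_mul, zero_mul, sub_mul, add_mul, mul_assoc, mul_smul_comm,
    smul_mul_assoc, smul_smul, hKL, mul_mul_of_mul_eq hKL, mul_mul_of_mul_eq hKx,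
    mul_mul_of_mul_eq hKy, mul_mul_of_mul_eq hLx] at h ⊢
  linear_combination (norm := module) (s ^ 3 * r ^ 3) • h

end GeneratorsTimesCartan

/-- For a doubly-linked pair of nodes (node 1 long, node 2 short),
`A_i = c_i e_i K_i + c̄_i f_i K_i + w_i K_i²` satisfy the doubly-linked generalized
q-Onsager relations, provided the constraint on `w₁, w₂` holds. -/
theorem stmt_3 (q : ℂ) (hq0 : q ≠ 0) (hqroot : ∀ n : ℕ, 0 < n → q ^ n ≠ 1)
    (A : Type*) [Ring A] [Algebra ℂ A]
    (e₁ e₂ f₁ f₂ : A) (K₁ K₂ : Aˣ)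
    (hKcomm : (K₁ : A) * (K₂ : A) = (K₂ : A) * (K₁ : A))
    (hK1e1 : (K₁ : A) * e₁ * ((K₁⁻¹ : Aˣ) : A) = (q ^ 2) • e₁)
    (hK1f1 : (K₁ : A) * f₁ * ((K₁⁻¹ : Aˣ) : A) = (q ^ 2)⁻¹ • f₁)
    (hK2e2 : (K₂ : A) * e₂ * ((K₂⁻¹ : Aˣ) : A) = q • e₂)
    (hK2f2 : (K₂ : A) * f₂ * ((K₂⁻¹ : Aˣ) : A) = q⁻¹ • f₂)
    (hK1e2 : (K₁ : A) * e₂ * ((K₁⁻¹ : Aˣ) : A) = q⁻¹ • e₂)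
    (hK1f2 : (K₁ : A) * f₂ * ((K₁⁻¹ : Aˣ) : A) = q • f₂)
    (hK2e1 : (K₂ : A) * e₁ * ((K₂⁻¹ : Aˣ) : A) = q⁻¹ • e₁)
    (hK2f1 : (K₂ : A) * f₁ * ((K₂⁻¹ : Aˣ) : A) = q • f₁)
    (hef1 : e₁ * f₁ - f₁ * e₁
      = (q ^ 2 - (q ^ 2)⁻¹)⁻¹ • ((K₁ : A) ^ 2 - ((K₁⁻¹ : Aˣ) : A) ^ 2))
    (hef2 : e₂ * f₂ - f₂ * e₂
      = (q - q⁻¹)⁻¹ • ((K₂ : A) ^ 2 - ((K₂⁻¹ : Aˣ) : A) ^ 2))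
    (hef12 : e₁ * f₂ = f₂ * e₁) (hef21 : e₂ * f₁ = f₁ * e₂)
    (hSe12 : e₁ ^ 2 * e₂ - (q ^ 2 + (q ^ 2)⁻¹) • (e₁ * e₂ * e₁) + e₂ * e₁ ^ 2 = 0)
    (hSf12 : f₁ ^ 2 * f₂ - (q ^ 2 + (q ^ 2)⁻¹) • (f₁ * f₂ * f₁) + f₂ * f₁ ^ 2 = 0)
    (hSe21 : e₂ ^ 3 * e₁ - (q ^ 2 + 1 + (q ^ 2)⁻¹) • (e₂ ^ 2 * e₁ * e₂)
      + (q ^ 2 + 1 + (q ^ 2)⁻¹) • (e₂ * e₁ * e₂ ^ 2) - e₁ * e₂ ^ 3 = 0)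
    (hSf21 : f₂ ^ 3 * f₁ - (q ^ 2 + 1 + (q ^ 2)⁻¹) • (f₂ ^ 2 * f₁ * f₂)
      + (q ^ 2 + 1 + (q ^ 2)⁻¹) • (f₂ * f₁ * f₂ ^ 2) - f₁ * f₂ ^ 3 = 0)
    (c₁ c₂ cb₁ cb₂ w₁ w₂ : ℂ)
    (hcon : w₂ * (w₁ ^ 2 + c₁ * cb₁ / (q ^ 2 + (q ^ 2)⁻¹ - 2)) = 0)
    (A₁ A₂ : A)
    (hA1 : A₁ = c₁ • (e₁ * (K₁ : A)) + cb₁ • (f₁ * (K₁ : A)) + w₁ • ((K₁ : A) ^ 2))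
    (hA2 : A₂ = c₂ • (e₂ * (K₂ : A)) + cb₂ • (f₂ * (K₂ : A)) + w₂ • ((K₂ : A) ^ 2)) :
    A₁ ^ 2 * A₂ - (q ^ 2 + (q ^ 2)⁻¹) • (A₁ * A₂ * A₁) + A₂ * A₁ ^ 2 = (c₁ * cb₁) • A₂
    ∧ A₂ ^ 3 * A₁ - (q ^ 2 + 1 + (q ^ 2)⁻¹) • (A₂ ^ 2 * A₁ * A₂)
        + (q ^ 2 + 1 + (q ^ 2)⁻¹) • (A₂ * A₁ * A₂ ^ 2) - A₁ * A₂ ^ 3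
      = (c₂ * cb₂ * (q + q⁻¹) ^ 2) • (A₂ * A₁ - A₁ * A₂) := by
  have hq2 : q ^ 2 - 1 ≠ 0 := sub_ne_zero.2 (hqroot 2 (by norm_num))
  have hq4 : (q ^ 2) ^ 2 - 1 ≠ 0 := by
    rw [← pow_mul]
    exact sub_ne_zero.2 (hqroot 4 (by norm_num))
  have hqq : q ^ 2 ≠ 0 := pow_ne_zero 2 hq0
  have hqi : q⁻¹ ≠ 0 := inv_ne_zero hq0
  replace hK1e1 := mul_eq_smul_mul_of_conj hK1e1
  replace hK1f1 := mul_eq_smul_mul_of_conj hK1f1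
  replace hK2e2 := mul_eq_smul_mul_of_conj hK2e2
  replace hK2f2 := mul_eq_smul_mul_of_conj hK2f2
  replace hK1e2 := mul_eq_smul_mul_of_conj hK1e2
  replace hK1f2 := mul_eq_smul_mul_of_conj hK1f2
  replace hK2e1 := mul_eq_smul_mul_of_conj hK2e1
  replace hK2f1 := mul_eq_smul_mul_of_conj hK2f1
  have hk : (K₁ : A) ^ 2 * (K₂ : A) ^ 2 = (K₂ : A) ^ 2 * (K₁ : A) ^ 2 :=
    (show Commute (K₁ : A) (K₂ : A) from hKcomm).pow_pow 2 2
  have hE2F1 := mul_mul_of_commute hq0 hef21 hK2f1 hK1e2 hKcomm.symm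
  have hE1F2 := mul_mul_of_commute hq0 hef12 hK1f2 hK2e1 hKcomm
  constructor
  · have h := IsQuantumTriple.of_generators hqq hq4 hK1e1 hK1f1 hef1
    have hE := h.quadratic_relation_raising hqq hq4
      (by rw [sq_mul_of_qcomm hK1e2 hKcomm, inv_pow]) hE2F1
      (quadratic_serre_mul_cartan hK1e1 hK1e2 hK2e1 hKcomm hSe12) c₁ cb₁ w₁
    have hF := h.quadratic_relation_lowering hqq hq4 (sq_mul_of_qcomm hK1f2 hKcomm) hE1F2
      (quadratic_serre_mul_cartan hK1f1 hK1f2 hK2f1 hKcomm hSf12) c₁ cb₁ w₁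
    have hC := h.quadratic_relation_cartan hqq hq4 hk
      (by rw [mul_sq_of_qcomm hqi hK2e1 hKcomm.symm, inv_pow, inv_inv])
      (mul_sq_of_qcomm hq0 hK2f1 hKcomm.symm) c₁ cb₁ w₁
    rw [← hA1] at hE hF hC
    have hw : w₂ * ((2 - q ^ 2 - (q ^ 2)⁻¹) * w₁ ^ 2 - c₁ * cb₁) = 0 := by
      have hne : q ^ 2 + (q ^ 2)⁻¹ - 2 ≠ 0 := by
        have : q ^ 2 + (q ^ 2)⁻¹ - 2 = (q ^ 2 - 1) ^ 2 * (q ^ 2)⁻¹ := by field_simp; ring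
        rw [this]
        exact mul_ne_zero (pow_ne_zero 2 hq2) (inv_ne_zero hqq)
      have hdiv := div_mul_cancel₀ (c₁ * cb₁) hne
      linear_combination -(q ^ 2 + (q ^ 2)⁻¹ - 2) * hcon + w₂ * hdiv
    have hz := congrArg (· • ((K₂ : A) ^ 2 * ((K₁ : A) ^ 2 * (K₁ : A) ^ 2))) hw
    simp only [zero_smul] at hz
    rw [hA2]
    simp only [mul_add, add_mul, mul_smul_comm, smul_mul_assoc]
    linear_combination (norm := module) c₂ • hE + cb₂ • hF + w₂ • hC + hz
  · have h := IsQuantumTriple.of_generators hq0 hq2 hK2e2 hK2f2 hef2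
    have hE := h.cubic_relation_raising hq0 hq2
      (by rw [sq_mul_of_qcomm hK2e1 hKcomm.symm, inv_pow]) hE1F2
      (cubic_serre_mul_cartan hK2e2 hK2e1 hK1e2 hKcomm.symm hSe21) c₂ cb₂ w₂
    have hF := h.cubic_relation_lowering hq0 hq2 (sq_mul_of_qcomm hK2f1 hKcomm.symm) hE2F1
      (cubic_serre_mul_cartan hK2f2 hK2f1 hK1f2 hKcomm.symm hSf21) c₂ cb₂ w₂
    have hC := h.cubic_relation_cartan hq0 hq2 hk.symm
      (by rw [mul_sq_of_qcomm hqi hK1e2 hKcomm, inv_pow, inv_inv])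
      (mul_sq_of_qcomm hq0 hK1f2 hKcomm) c₂ cb₂ w₂
    rw [← hA2] at hE hF hC
    rw [hA1]
    simp only [mul_add, add_mul, mul_smul_comm, smul_mul_assoc]
    linear_combination (norm := module) c₁ • hE + cb₁ • hF + w₁ • hC
end

section
/- Fix n ≥ 2 and let c_i, c̄_i, w_i ∈ ℂ for i ∈ ℤ/(n+1)ℤ; define A_i = c_i e_i K_i + c̄_i f_i K_i + w_i K_i². If for every adjacent pair (i,j) (i.e. j = i ± 1) the constraint w_i (w_j² + c_j c̄_j/(q + q⁻¹ − 2)) = 0 holds, then the A_i satisfy all defining relations of the generalized q-Onsager algebra O_q(a_n⁽¹⁾): for every adjacent pair (i,j), A_i²A_j − (q + q⁻¹) A_iA_jA_i + A_jA_i² = c_i c̄_i A_j, and for every non-adjacent pair of distinct indices i, j, A_iA_j = A_jA_i. -/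
section QOnsager

variable {A : Type*} [Ring A] [Algebra ℂ A]

/-- A relation `a * b = t • (b * a)` in the form used to move `a` past `b` inside a longer word. -/
theorem mul_mul_of_q_commute {a b : A} {t : ℂ} (h : a * b = t • (b * a)) (z : A) :
    a * (b * z) = t • (b * (a * z)) := by
  rw [← mul_assoc, h, smul_mul_assoc, mul_assoc]

/-- A conjugation relation by a unit as a `q`-commutation relation. -/
theorem q_commute_of_conj {k : Aˣ} {x : A} {t : ℂ}
    (h : (k : A) * x * ((k⁻¹ : Aˣ) : A) = t • x) : (k : A) * x = t • (x * k) := by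
  rw [← smul_mul_assoc, ← h, Units.inv_mul_cancel_right]

/-- The `q`-Dolan–Grady relation against an element which `q`-commutes with `F` and `L` and
satisfies the `q`-Serre relation with `E`. -/
theorem q_dolan_grady_of_q_serre {q : ℂ} (hq0 : q ≠ 0) (hq2 : q ^ 2 - 1 ≠ 0)
    {E F L y : A} (hLE : L * E = q ^ 2 • (E * L)) (hLF : L * F = (q⁻¹) ^ 2 • (F * L))
    (hFE : F * E = q ^ 2 • (E * F) - (q * (q - q⁻¹)⁻¹) • (L * L - 1))
    (hLy : L * y = q⁻¹ • (y * L)) (hFy : F * y = q⁻¹ • (y * F))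
    (hS : E * (E * y) = (q + q⁻¹) • (E * (y * E)) - y * (E * E)) (c b w : ℂ) :
    (c • E + b • F + w • L) ^ 2 * y
      - (q + q⁻¹) • ((c • E + b • F + w • L) * y * (c • E + b • F + w • L))
      + y * (c • E + b • F + w • L) ^ 2 = (c * b) • y := by
  simp only [pow_two (_ + _ : A), add_mul, mul_add, smul_mul_assoc, mul_smul_comm, mul_assoc,
    hLE, hLF, hFE, hLy, mul_mul_of_q_commute hLy, hFy, mul_mul_of_q_commute hFy, hS, sub_mul,
    mul_sub, one_mul, mul_one, smul_sub]
  have hd : q - q⁻¹ ≠ 0 := fun h ↦ hq2 (by field_simp at h; linear_combination h)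
  match_scalars <;> field_simp <;> ring

/-- The `q`-Dolan–Grady relation against an element which `q`-commutes with `E` and `F` and
commutes with `L`. -/
theorem q_dolan_grady_of_q_commute {q : ℂ} (hq0 : q ≠ 0) (hq2 : q ^ 2 - 1 ≠ 0)
    {E F L y : A} (hLE : L * E = q ^ 2 • (E * L)) (hLF : L * F = (q⁻¹) ^ 2 • (F * L))
    (hFE : F * E = q ^ 2 • (E * F) - (q * (q - q⁻¹)⁻¹) • (L * L - 1))
    (hLy : L * y = (1 : ℂ) • (y * L)) (hEy : E * y = q • (y * E)) (hFy : F * y = q⁻¹ • (y * F))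
    (c b w v : ℂ) (hv : v * (w ^ 2 * (q + q⁻¹ - 2) + c * b) = 0) :
    (c • E + b • F + w • L) ^ 2 * (v • y)
      - (q + q⁻¹) • ((c • E + b • F + w • L) * (v • y) * (c • E + b • F + w • L))
      + (v • y) * (c • E + b • F + w • L) ^ 2 = (c * b) • (v • y) := by
  simp only [pow_two (_ + _ : A), add_mul, mul_add, smul_mul_assoc, mul_smul_comm, mul_assoc,
    hLE, hLF, hFE, hLy, mul_mul_of_q_commute hLy, hEy, mul_mul_of_q_commute hEy, hFy,
    mul_mul_of_q_commute hFy, sub_mul, mul_sub, one_mul, mul_one, smul_sub]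
  have hd : q - q⁻¹ ≠ 0 := fun h ↦ hq2 (by field_simp at h; linear_combination h)
  linear_combination (norm := skip) -hv • (y * (L * L))
  match_scalars <;> field_simp <;> ring

/-- `q`-commutation of `x k` and `y l`, where `k`, `l` scale `y`, `x`. -/
theorem mul_q_commute_mul {x y k l : A} {t u : ℂ} (hu : u ≠ 0) (hkl : k * l = l * k)
    (hky : k * y = t • (y * k)) (hlx : l * x = u • (x * l)) (hxy : x * y = y * x) :
    (x * k) * (y * l) = (t * u⁻¹) • ((y * l) * (x * k)) := by
  simp only [mul_assoc, mul_mul_of_q_commute hky, mul_mul_of_q_commute hlx, mul_smul_comm, hkl]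
  rw [← mul_assoc x y, hxy, mul_assoc, smul_smul, inv_mul_cancel_right₀ hu]

/-- The `q`-Serre relation is preserved by multiplying by Cartan elements. -/
theorem q_serre_mul_cartan {x y k l : A} {r t u : ℂ} (hkl : k * l = l * k)
    (hkx : k * x = r • (x * k)) (hky : k * y = t • (y * k)) (hlx : l * x = t • (x * l))
    (hS : x ^ 2 * y - u • (x * y * x) + y * x ^ 2 = 0) :
    (x * k) * ((x * k) * (y * l))
      = u • ((x * k) * ((y * l) * (x * k))) - (y * l) * ((x * k) * (x * k)) := by
  have hlk : ∀ z, l * (k * z) = k * (l * z) := fun z ↦ by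
    rw [← mul_assoc, ← hkl, mul_assoc]
  have hS' : x * (x * y) = u • (x * (y * x)) - y * (x * x) := by
    simp only [pow_two, mul_assoc] at hS
    linear_combination (norm := module) hS
  have hS'' : x * (x * (y * (k * (k * l))))
      = u • (x * (y * (x * (k * (k * l))))) - y * (x * (x * (k * (k * l)))) := by
    simpa only [mul_assoc, sub_mul, smul_mul_assoc] using congrArg (· * (k * (k * l))) hS'
  simp only [mul_assoc, mul_mul_of_q_commute hkx, mul_mul_of_q_commute hky,
    mul_mul_of_q_commute hlx, mul_smul_comm, hlk, ← hkl, hS'']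
  module

/-- The algebraic relations among `e K`, `f K` and `K²` at a single node. -/
theorem cartan_relations {q : ℂ} (hq0 : q ≠ 0) {e f : A} {K : Aˣ}
    (hKe : (K : A) * e = q • (e * K)) (hKf : (K : A) * f = q⁻¹ • (f * K))
    (hef : e * f - f * e = (q - q⁻¹)⁻¹ • ((K : A) ^ 2 - ((K⁻¹ : Aˣ) : A) ^ 2)) :
    (K : A) ^ 2 * (e * K) = q ^ 2 • (e * K * (K : A) ^ 2)
    ∧ (K : A) ^ 2 * (f * K) = (q⁻¹) ^ 2 • (f * K * (K : A) ^ 2)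
    ∧ (f * K) * (e * K) = q ^ 2 • (e * K * (f * K))
      - (q * (q - q⁻¹)⁻¹) • ((K : A) ^ 2 * (K : A) ^ 2 - 1) := by
  have hfe : f * (e * (K * K)) = e * (f * (K * K))
      - (q - q⁻¹)⁻¹ • ((K : A) * (K * (K * K)) - 1) := by
    have h := congrArg (· * ((K : A) * K)) hef
    simp only [sub_mul, smul_mul_assoc, pow_two, mul_assoc, Units.inv_mul_cancel_left,
      Units.inv_mul] at h
    rw [← h]; abel
  refine ⟨?_, ?_, ?_⟩
  · simp only [pow_two, mul_assoc, mul_mul_of_q_commute hKe, mul_smul_comm, smul_smul]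
  · simp only [pow_two, mul_assoc, mul_mul_of_q_commute hKf, mul_smul_comm, smul_smul]
  · simp only [pow_two (K : A), mul_assoc, mul_mul_of_q_commute hKe, mul_mul_of_q_commute hKf,
      mul_smul_comm, hfe]
    match_scalars <;> field_simp

end QOnsager

/-- In `U_q(a_n⁽¹⁾)` (nodes indexed by `ZMod (n+1)`, `n ≥ 2`), the
elements `A_i = c_i e_i K_i + c̄_i f_i K_i + w_i K_i²` satisfy all defining relations
of the generalized q-Onsager algebra `O_q(a_n⁽¹⁾)`, provided the constraints on the
`w_i` hold for every adjacent pair. -/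
theorem stmt_6 (n : ℕ) (hn : 2 ≤ n)
    (s : ℂ) (hs0 : s ≠ 0) (hsroot : ∀ m : ℕ, 0 < m → s ^ m ≠ 1)
    (q : ℂ) (hq : q = s ^ 2)
    (Adj : ZMod (n + 1) → ZMod (n + 1) → Prop)
    (hAdj : ∀ i j, Adj i j ↔ (j = i + 1 ∨ j = i - 1))
    (A : Type*) [Ring A] [Algebra ℂ A]
    (e f : ZMod (n + 1) → A) (K : ZMod (n + 1) → Aˣ)
    (hKcomm : ∀ i j, (K i : A) * (K j : A) = (K j : A) * (K i : A))
    (hKeK : ∀ i, (K i : A) * e i * (((K i)⁻¹ : Aˣ) : A) = q • e i)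
    (hKfK : ∀ i, (K i : A) * f i * (((K i)⁻¹ : Aˣ) : A) = q⁻¹ • f i)
    (hKeKadj : ∀ i j, Adj i j → (K i : A) * e j * (((K i)⁻¹ : Aˣ) : A) = s⁻¹ • e j)
    (hKfKadj : ∀ i j, Adj i j → (K i : A) * f j * (((K i)⁻¹ : Aˣ) : A) = s • f j)
    (hKeKnadj : ∀ i j, i ≠ j → ¬ Adj i j →
      (K i : A) * e j * (((K i)⁻¹ : Aˣ) : A) = e j)
    (hKfKnadj : ∀ i j, i ≠ j → ¬ Adj i j →
      (K i : A) * f j * (((K i)⁻¹ : Aˣ) : A) = f j)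
    (hef : ∀ i, e i * f i - f i * e i
      = (q - q⁻¹)⁻¹ • ((K i : A) ^ 2 - (((K i)⁻¹ : Aˣ) : A) ^ 2))
    (hef' : ∀ i j, i ≠ j → e i * f j = f j * e i)
    (hSerre_e : ∀ i j, Adj i j →
      e i ^ 2 * e j - (q + q⁻¹) • (e i * e j * e i) + e j * e i ^ 2 = 0)
    (hSerre_f : ∀ i j, Adj i j →
      f i ^ 2 * f j - (q + q⁻¹) • (f i * f j * f i) + f j * f i ^ 2 = 0)
    (hcomm_e : ∀ i j, i ≠ j → ¬ Adj i j → e i * e j = e j * e i)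
    (hcomm_f : ∀ i j, i ≠ j → ¬ Adj i j → f i * f j = f j * f i)
    (c cb w : ZMod (n + 1) → ℂ)
    (hcon : ∀ i j, Adj i j → w i * (w j ^ 2 + c j * cb j / (q + q⁻¹ - 2)) = 0)
    (X : ZMod (n + 1) → A)
    (hX : ∀ i, X i = c i • (e i * (K i : A)) + cb i • (f i * (K i : A))
      + w i • ((K i : A) ^ 2)) :
    (∀ i j, Adj i j →
      X i ^ 2 * X j - (q + q⁻¹) • (X i * X j * X i) + X j * X i ^ 2 = (c i * cb i) • X j)
    ∧ (∀ i j, i ≠ j → ¬ Adj i j → X i * X j = X j * X i) := by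
  have hq0 : q ≠ 0 := hq ▸ pow_ne_zero 2 hs0
  have hq2 : q ^ 2 - 1 ≠ 0 := fun h ↦ hsroot 4 (by norm_num) (by
    rw [hq] at h; linear_combination h)
  have hqi2 : (q⁻¹) ^ 2 - 1 ≠ 0 := fun h ↦ hq2 (by
    field_simp at h; linear_combination -h)
  have hqq : q + q⁻¹ - 2 ≠ 0 := fun h ↦ hsroot 2 (by norm_num) (by
    have h' : (q - 1) ^ 2 = 0 := by field_simp at h; linear_combination h
    rw [← hq]; linear_combination pow_eq_zero_iff (two_ne_zero) |>.mp h')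
  have hsymm : ∀ i j, Adj i j → Adj j i := fun i j h ↦ by
    rw [hAdj] at h ⊢
    rcases h with rfl | rfl
    · right; ring
    · left; ring
  have hirr : ∀ i j, Adj i j → i ≠ j := by
    rintro i _ h rfl
    have : Fact (1 < n + 1) := ⟨by omega⟩
    rw [hAdj] at h
    rcases h with h | h
    · exact one_ne_zero (left_eq_add.mp h)
    · exact one_ne_zero (sub_eq_self.mp h.symm)
  refine ⟨fun i j hij ↦ ?_, fun i j hne hij ↦ ?_⟩
  · have hji := hsymm i j hij
    have hne := hirr i j hij
    obtain ⟨hLE, hLF, hFE⟩ := cartan_relations hq0 (q_commute_of_conj (hKeK i))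
      (q_commute_of_conj (hKfK i)) (hef i)
    have hKe := q_commute_of_conj (hKeKadj i j hij)
    have hKf := q_commute_of_conj (hKfKadj i j hij)
    have hKe' := q_commute_of_conj (hKeKadj j i hji)
    have hKf' := q_commute_of_conj (hKfKadj j i hji)
    have hk := hKcomm i j
    have hkL : ∀ z, (K i : A) * ((K j : A) * z) = (K j : A) * ((K i : A) * z) := fun z ↦ by
      rw [← mul_assoc, hk, mul_assoc]
    have hss : q⁻¹ = s⁻¹ * s⁻¹ := by rw [hq]; field_simp
    have hss' : q = s * s := by rw [hq, pow_two]
    have he := q_dolan_grady_of_q_serre (y := e j * (K j : A)) hq0 hq2 hLE hLF hFE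
      (by simp only [pow_two, mul_assoc, mul_mul_of_q_commute hKe, mul_smul_comm, hkL, hk,
            smul_smul, ← hss])
      (by rw [hss]
          exact mul_q_commute_mul hs0 hk hKe hKf' (hef' j i hne.symm).symm)
      (q_serre_mul_cartan hk
        (q_commute_of_conj (hKeK i)) hKe hKe' (hSerre_e i j hij)) (c i) (cb i) (w i)
    have hf := q_dolan_grady_of_q_serre (q := q⁻¹) (E := f i * (K i : A)) (F := e i * (K i : A))
      (L := (K i : A) ^ 2) (y := f j * (K j : A)) (inv_ne_zero hq0) hqi2 hLF
      (by rw [inv_inv]; exact hLE)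
      (by
        have hd : q - q⁻¹ ≠ 0 := fun h ↦ hq2 (by field_simp at h; linear_combination h)
        rw [hFE, inv_inv, ← neg_sub q q⁻¹, inv_neg]
        match_scalars <;> field_simp <;> ring)
      (by simp only [pow_two, mul_assoc, mul_mul_of_q_commute hKf, mul_smul_comm, hkL, hk,
            smul_smul, ← hss', inv_inv])
      (by
        have h := mul_q_commute_mul (inv_ne_zero hs0) hk hKf hKe' (hef' i j hne)
        rw [inv_inv, ← hss'] at h
        rwa [inv_inv])
      (q_serre_mul_cartan hk
        (q_commute_of_conj (hKfK i)) hKf hKf'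
        (by rw [inv_inv, add_comm q⁻¹ q]; exact hSerre_f i j hij)) (cb i) (c i) (w i)
    rw [inv_inv, add_comm q⁻¹ q, add_comm (cb i • _) (c i • _), mul_comm (cb i) (c i)] at hf
    have hL := q_dolan_grady_of_q_commute (y := (K j : A) ^ 2) hq0 hq2 hLE hLF hFE
      (by simp only [pow_two, mul_assoc, hkL, hk, one_smul])
      (by
        have h : (K j : A) ^ 2 * (e i * (K i : A)) = q⁻¹ • (e i * (K i : A) * (K j : A) ^ 2) := by
          simp only [pow_two, mul_assoc, mul_mul_of_q_commute hKe', mul_smul_comm, hkL, hk,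
            smul_smul, ← hss]
        rw [h, smul_smul, mul_inv_cancel₀ hq0, one_smul])
      (by
        have h : (K j : A) ^ 2 * (f i * (K i : A)) = q • (f i * (K i : A) * (K j : A) ^ 2) := by
          simp only [pow_two, mul_assoc, mul_mul_of_q_commute hKf', mul_smul_comm, hkL, hk,
            smul_smul, ← hss']
        rw [h, smul_smul, inv_mul_cancel₀ hq0, one_smul])
      (c i) (cb i) (w i) (w j) (by
        linear_combination (q + q⁻¹ - 2) * hcon j i hji
          - w j * div_mul_cancel₀ (c i * cb i) hqq)
    rw [← hX i] at he hf hL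
    rw [hX j]
    simp only [mul_add, add_mul, smul_add, mul_smul_comm, smul_mul_assoc] at hL ⊢
    linear_combination (norm := module) c j • he + cb j • hf + hL
  · have hji : ¬ Adj j i := fun h ↦ hij (hsymm j i h)
    have comm_of_conj : ∀ (k : Aˣ) (x : A), (k : A) * x * ((k⁻¹ : Aˣ) : A) = x →
        Commute (k : A) x := fun k x h ↦ (Units.mul_inv_eq_iff_eq_mul k).mp h
    have h1 := comm_of_conj _ _ (hKeKnadj i j hne hij)
    have h2 := comm_of_conj _ _ (hKfKnadj i j hne hij)
    have h3 := (comm_of_conj _ _ (hKeKnadj j i hne.symm hji)).symm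
    have h4 := (comm_of_conj _ _ (hKfKnadj j i hne.symm hji)).symm
    have h5 : Commute (K i : A) (K j : A) := hKcomm i j
    have h6 : Commute (e i) (e j) := hcomm_e i j hne hij
    have h7 : Commute (f i) (f j) := hcomm_f i j hne hij
    have h8 : Commute (e i) (f j) := hef' i j hne
    have h9 : Commute (f i) (e j) := (hef' j i hne.symm).symm
    have key : ∀ x : A, Commute x (e j) → Commute x (f j) → Commute x (K j : A) →
        Commute x (X j) := fun x he hf hK ↦ by
      rw [hX j]
      exact (((he.mul_right hK).smul_right _).add_right ((hf.mul_right hK).smul_right _)).add_right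
        ((hK.pow_right 2).smul_right _)
    have hK := key _ h1 h2 h5
    have hXX : Commute (X i) (X j) := by
      rw [hX i]
      exact ((((key _ h6 h8 h3).mul_left hK).smul_left _).add_left
        (((key _ h9 h7 h4).mul_left hK).smul_left _)).add_left ((hK.pow_left 2).smul_left _)
    exact hXX
end

section
/- Let c₀, c₁, c̄₀, c̄₁ ∈ ℂ, and let 𝖠₀, 𝖠₁ be elements of a unital associative ℂ-algebra B satisfying the q-Dolan–Grady relations with parameters ρ_i = c_i c̄_i (q + q⁻¹)². Then in the tensor product algebra A ⊗_ℂ B the elements D_i = (c_i e_i K_i + c̄_i f_i K_i) ⊗ 1 + K_i² ⊗ 𝖠_i (i = 0,1), given by the coaction map of the q-Onsager algebra, again satisfy the q-Dolan–Grady relations with the same parameters ρ_i = c_i c̄_i (q + q⁻¹)²: D_i³D_j − [3]_q D_i²D_jD_i + [3]_q D_iD_jD_i² − D_jD_i³ = ρ_i (D_iD_j − D_jD_i) for both (i,j) = (0,1) and (i,j) = (1,0). -/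
open TensorProduct

/-- The `q`-Dolan–Grady expression `x³y - [3] x²yx + [3] xyx² - yx³ - ρ [x, y]`, which vanishes
exactly when the relation of `x` with `y` holds. -/
noncomputable def dolanGrady {R : Type*} [Ring R] [Algebra ℂ R] (q ρ : ℂ) (x y : R) : R :=
  x ^ 3 * y - (q ^ 2 + 1 + (q ^ 2)⁻¹) • (x ^ 2 * y * x)
    + (q ^ 2 + 1 + (q ^ 2)⁻¹) • (x * y * x ^ 2) - y * x ^ 3 - ρ • (x * y - y * x)

/-- Over `x = E + F + P`, an element `Z` that `q`-commutes with `F`, `P` and `M` and satisfies the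
`q`-Serre relation with `E` satisfies the `q`-Dolan–Grady relation. -/
theorem dolanGrady_eq_zero_of_serre {R : Type*} [Ring R] [Algebra ℂ R] {q κ : ℂ} (hq : q ≠ 0)
    {E F P M Z : R}
    (hFE : F * E = q ^ 2 • (E * F) - (q * κ) • (M - 1))
    (hPE : P * E = q ^ 2 • (E * P)) (hPF : P * F = (q ^ 2)⁻¹ • (F * P))
    (hME : M * E = q ^ 4 • (E * M)) (hMF : M * F = (q ^ 4)⁻¹ • (F * M))
    (hMP : M * P = P * M)
    (hFZ : F * Z = (q ^ 2)⁻¹ • (Z * F)) (hPZ : P * Z = (q ^ 2)⁻¹ • (Z * P))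
    (hMZ : M * Z = (q ^ 4)⁻¹ • (Z * M))
    (hEZ : dolanGrady q 0 E Z = 0) :
    dolanGrady q (κ * (q - q⁻¹) * (q + q⁻¹) ^ 2) (E + F + P) Z = 0 := by
  have hEZ' : E * (E * (E * Z)) = (q ^ 2 + 1 + (q ^ 2)⁻¹) • (E * (E * (Z * E)))
      - (q ^ 2 + 1 + (q ^ 2)⁻¹) • (E * (Z * (E * E))) + Z * (E * (E * E)) := by
    rw [← sub_eq_zero, ← hEZ]
    simp only [dolanGrady, pow_succ, pow_zero, one_mul, mul_assoc]
    module
  have assoc {x y z : R} (h : x * y = z) (w : R) : x * (y * w) = z * w := by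
    rw [← mul_assoc, h]
  simp only [dolanGrady, pow_succ _ 2, pow_two (E + F + P), add_mul, mul_add, sub_mul, mul_sub,
    mul_assoc, smul_mul_assoc, mul_smul_comm, one_mul, mul_one, hEZ',
    hFE, hPE, hPF, hME, hMF, hMP, hFZ, hPZ, hMZ,
    assoc hFE, assoc hPE, assoc hPF, assoc hFZ, assoc hPZ]
  match_scalars <;> field_simp <;> ring

/-- Over `x = E + F + P`, an element `Z` that `q`-commutes with `E`, `F` and `M` and satisfies a
rescaled `q`-Dolan–Grady relation with `P` satisfies the `q`-Dolan–Grady relation. -/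
theorem dolanGrady_eq_zero_of_rescaled {R : Type*} [Ring R] [Algebra ℂ R] {q κ : ℂ} (hq : q ≠ 0)
    {E F P M Z : R}
    (hFE : F * E = q ^ 2 • (E * F) - (q * κ) • (M - 1))
    (hPE : P * E = q ^ 2 • (E * P)) (hPF : P * F = (q ^ 2)⁻¹ • (F * P))
    (hME : M * E = q ^ 4 • (E * M)) (hMF : M * F = (q ^ 4)⁻¹ • (F * M))
    (hPM : P * M = M * P)
    (hZE : Z * E = (q ^ 2)⁻¹ • (E * Z)) (hZF : Z * F = q ^ 2 • (F * Z))
    (hZM : Z * M = M * Z)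
    (hPZ : dolanGrady q 0 P Z = (κ * (q - q⁻¹) * (q + q⁻¹) ^ 2) • (M * (P * Z - Z * P))) :
    dolanGrady q (κ * (q - q⁻¹) * (q + q⁻¹) ^ 2) (E + F + P) Z = 0 := by
  have hPZ' : P * (P * (P * Z)) = (q ^ 2 + 1 + (q ^ 2)⁻¹) • (P * (P * (Z * P)))
      - (q ^ 2 + 1 + (q ^ 2)⁻¹) • (P * (Z * (P * P))) + Z * (P * (P * P))
      + (κ * (q - q⁻¹) * (q + q⁻¹) ^ 2) • (M * (P * Z) - M * (Z * P)) := by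
    rw [← mul_sub, ← hPZ]
    simp only [dolanGrady, pow_succ, pow_zero, one_mul, mul_assoc]
    module
  have assoc {x y z : R} (h : x * y = z) (w : R) : x * (y * w) = z * w := by
    rw [← mul_assoc, h]
  simp only [dolanGrady, pow_succ _ 2, pow_two (E + F + P), add_mul, mul_add, sub_mul, mul_sub,
    mul_assoc, smul_mul_assoc, mul_smul_comm, one_mul, mul_one, hPZ',
    hFE, hPE, hPF, hME, hMF, hZE, hZF, hZM,
    assoc hFE, assoc hPE, assoc hPF, assoc hME, assoc hMF, assoc hPM, assoc hZE, assoc hZF,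
    assoc hZM]
  match_scalars <;> field_simp <;> ring

section

variable {R : Type*} [Ring R] [Algebra ℂ R]

theorem dolanGrady_eq_zero_iff {q ρ : ℂ} {x y : R} :
    dolanGrady q ρ x y = 0 ↔
      x ^ 3 * y - (q ^ 2 + 1 + (q ^ 2)⁻¹) • (x ^ 2 * y * x)
        + (q ^ 2 + 1 + (q ^ 2)⁻¹) • (x * y * x ^ 2) - y * x ^ 3 = ρ • (x * y - y * x) :=
  sub_eq_zero

theorem dolanGrady_add_right (q ρ : ℂ) (x y z : R) :
    dolanGrady q ρ x (y + z) = dolanGrady q ρ x y + dolanGrady q ρ x z := by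
  simp only [dolanGrady, mul_add, add_mul]
  module

theorem dolanGrady_inv (q ρ : ℂ) (x y : R) : dolanGrady q⁻¹ ρ x y = dolanGrady q ρ x y := by
  have h : (q⁻¹ ^ 2 + 1 + (q⁻¹ ^ 2)⁻¹) = q ^ 2 + 1 + (q ^ 2)⁻¹ := by
    rw [inv_pow, inv_inv]; ring
  simp only [dolanGrady, h]

theorem map_dolanGrady {S : Type*} [Ring S] [Algebra ℂ S] (φ : R →ₐ[ℂ] S) (q ρ : ℂ) (x y : R) :
    φ (dolanGrady q ρ x y) = dolanGrady q ρ (φ x) (φ y) := by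
  simp only [dolanGrady, map_add, map_sub, map_mul, map_pow, map_smul]

/-- Multiplying two elements on the right by suitably `q`-commuting elements rescales the
`q`-Serre expression. -/
theorem dolanGrady_smul_mul {q s t : ℂ} (hs : s * t = 1) {e k e' k' : R} (c c' : ℂ)
    (hke : k * e = s • (e * k)) (hke' : k * e' = t • (e' * k))
    (hk'e : k' * e = t • (e * k')) (hkk' : k' * k = k * k') :
    dolanGrady q 0 (c • (e * k)) (c' • (e' * k'))
      = (c ^ 3 * c') • (dolanGrady q 0 e e' * (k * (k * (k * k')))) := by
  have assoc {x y z : R} (h : x * y = z) (w : R) : x * (y * w) = z * w := by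
    rw [← mul_assoc, h]
  obtain rfl : t = s⁻¹ := eq_inv_of_mul_eq_one_right hs
  have hs0 : s ≠ 0 := left_ne_zero_of_mul_eq_one hs
  simp only [dolanGrady, pow_succ _ 2, pow_two (e : R), pow_two (c • (e * k)), add_mul,
    sub_mul, mul_assoc, smul_mul_assoc, mul_smul_comm, hkk', assoc hke, assoc hke', assoc hk'e, assoc hkk']
  match_scalars <;> field_simp <;> ring

/-- The coaction formula inside a single algebra in which `a`, `b` commute with the generators
`e, f, k, e', f', k'`; here `l` is the inverse of `k`. -/
theorem dolanGrady_coaction {q : ℂ} (hq : q ≠ 0) (hq2 : q ^ 2 ≠ 1) {c cb c' cb' : ℂ}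
    {e f k l e' f' k' a b : R}
    (hke : k * e = q • (e * k)) (hkf : k * f = q⁻¹ • (f * k))
    (hke' : k * e' = q⁻¹ • (e' * k)) (hkf' : k * f' = q • (f' * k))
    (hk'e : k' * e = q⁻¹ • (e * k')) (hk'f : k' * f = q • (f * k'))
    (hkk' : k' * k = k * k') (hlk : l * k = 1)
    (hef : e * f - f * e = (q - q⁻¹)⁻¹ • (k ^ 2 - l ^ 2))
    (hef' : e * f' = f' * e) (hfe' : e' * f = f * e')
    (hSe : dolanGrady q 0 e e' = 0) (hSf : dolanGrady q 0 f f' = 0)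
    (hae : a * e = e * a) (haf : a * f = f * a) (hak : a * k = k * a)
    (hae' : a * e' = e' * a) (haf' : a * f' = f' * a) (hak' : a * k' = k' * a)
    (hbe : b * e = e * b) (hbf : b * f = f * b) (hbk : b * k = k * b)
    (hab : dolanGrady q (c * cb * (q + q⁻¹) ^ 2) a b = 0) :
    dolanGrady q (c * cb * (q + q⁻¹) ^ 2) (c • (e * k) + cb • (f * k) + k ^ 2 * a)
      (c' • (e' * k') + cb' • (f' * k') + k' ^ 2 * b) = 0 := by
  have assoc {x y z : R} (h : x * y = z) (w : R) : x * (y * w) = z * w := by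
    rw [← mul_assoc, h]
  have hfe : f * e = e * f - (q - q⁻¹)⁻¹ • (k * k - l * l) := by
    rw [← pow_two, ← pow_two, ← hef]; abel
  have hq2' : q ^ 2 - 1 ≠ 0 := sub_ne_zero.mpr hq2
  have hρ : c * cb * (q + q⁻¹) ^ 2
      = c * cb * (q - q⁻¹)⁻¹ * (q - q⁻¹) * (q + q⁻¹) ^ 2 := by
    field_simp
  have hFE : cb • (f * k) * c • (e * k) = q ^ 2 • (c • (e * k) * cb • (f * k))
      - (q * (c * cb * (q - q⁻¹)⁻¹)) • (k ^ 4 - 1) := by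
    simp only [pow_succ, pow_zero, one_mul, mul_assoc, smul_mul_assoc, mul_smul_comm, sub_mul,
      assoc hke, assoc hkf, assoc hfe, hlk, assoc hlk]
    match_scalars <;> field_simp
  have hPE : k ^ 2 * a * c • (e * k) = q ^ 2 • (c • (e * k) * (k ^ 2 * a)) := by
    simp only [pow_two k, mul_assoc, smul_mul_assoc, mul_smul_comm, assoc hke, hak,
      assoc hae]
    match_scalars; field_simp
  have hPF : k ^ 2 * a * cb • (f * k) = (q ^ 2)⁻¹ • (cb • (f * k) * (k ^ 2 * a)) := by
    simp only [pow_two k, mul_assoc, smul_mul_assoc, mul_smul_comm, assoc hkf, hak,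
      assoc haf]
    match_scalars; field_simp
  have hME : k ^ 4 * c • (e * k) = q ^ 4 • (c • (e * k) * k ^ 4) := by
    simp only [pow_succ k, pow_zero, one_mul, mul_assoc, smul_mul_assoc, mul_smul_comm, assoc hke]
    match_scalars; field_simp
  have hMF : k ^ 4 * cb • (f * k) = (q ^ 4)⁻¹ • (cb • (f * k) * k ^ 4) := by
    simp only [pow_succ k, pow_zero, one_mul, mul_assoc, smul_mul_assoc, mul_smul_comm, assoc hkf]
    match_scalars; field_simp
  have hMP : k ^ 4 * (k ^ 2 * a) = k ^ 2 * a * k ^ 4 := by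
    simp only [pow_succ k, pow_zero, one_mul, mul_assoc, hak, assoc hak]
  rw [hρ, dolanGrady_add_right, dolanGrady_add_right]
  have hZe : dolanGrady q (c * cb * (q - q⁻¹)⁻¹ * (q - q⁻¹) * (q + q⁻¹) ^ 2)
      (c • (e * k) + cb • (f * k) + k ^ 2 * a) (c' • (e' * k')) = 0 := by
    refine dolanGrady_eq_zero_of_serre hq hFE hPE hPF hME hMF hMP ?_ ?_ ?_ ?_
    · simp only [mul_assoc, smul_mul_assoc, mul_smul_comm, assoc hke', assoc hk'f, hkk',
        assoc hfe']
      match_scalars; field_simp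
    · simp only [pow_two k, mul_assoc, smul_mul_assoc, mul_smul_comm, assoc hke',
        assoc hkk', assoc hae', hak']
      match_scalars; field_simp
    · simp only [pow_succ k, pow_zero, one_mul, mul_assoc, smul_mul_assoc, mul_smul_comm,
        assoc hke', hkk', assoc hkk']
      match_scalars; field_simp
    · rw [dolanGrady_smul_mul (mul_inv_cancel₀ hq) c c' hke hke' hk'e hkk', hSe, zero_mul,
        smul_zero]
  have hZf : dolanGrady q (c * cb * (q - q⁻¹)⁻¹ * (q - q⁻¹) * (q + q⁻¹) ^ 2)
      (c • (e * k) + cb • (f * k) + k ^ 2 * a) (cb' • (f' * k')) = 0 := by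
    have hκ : c * cb * (q - q⁻¹)⁻¹ * (q - q⁻¹) * (q + q⁻¹) ^ 2
        = -(c * cb * (q - q⁻¹)⁻¹) * (q⁻¹ - q⁻¹⁻¹) * (q⁻¹ + q⁻¹⁻¹) ^ 2 := by
      rw [inv_inv]; ring
    rw [← dolanGrady_inv, hκ, add_comm (c • (e * k))]
    refine dolanGrady_eq_zero_of_serre (M := k ^ 4) (inv_ne_zero hq) ?_ ?_ ?_ ?_ ?_ hMP ?_ ?_ ?_ ?_
    · rw [hFE]
      match_scalars <;> field_simp <;> ring
    · rw [hPF, inv_pow]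
    · rw [hPE, inv_pow, inv_inv]
    · rw [hMF, inv_pow]
    · rw [hME, inv_pow, inv_inv]
    · simp only [mul_assoc, smul_mul_assoc, mul_smul_comm, assoc hkf', assoc hk'e, hkk',
        assoc hef']
      match_scalars; field_simp
    · simp only [pow_two k, mul_assoc, smul_mul_assoc, mul_smul_comm, assoc hkf',
        assoc hkk', assoc haf', hak']
      match_scalars; field_simp
    · simp only [pow_succ k, pow_zero, one_mul, mul_assoc, smul_mul_assoc, mul_smul_comm,
        assoc hkf', hkk', assoc hkk']
      match_scalars; field_simp
    · rw [dolanGrady_inv, dolanGrady_smul_mul (inv_mul_cancel₀ hq) cb cb' hkf hkf' hk'f hkk', hSf,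
        zero_mul, smul_zero]
  have hZb : dolanGrady q (c * cb * (q - q⁻¹)⁻¹ * (q - q⁻¹) * (q + q⁻¹) ^ 2)
      (c • (e * k) + cb • (f * k) + k ^ 2 * a) (k' ^ 2 * b) = 0 := by
    refine dolanGrady_eq_zero_of_rescaled hq hFE hPE hPF hME hMF hMP.symm ?_ ?_ ?_ ?_
    · simp only [pow_two k', mul_assoc, smul_mul_assoc, mul_smul_comm, assoc hk'e,
        assoc hkk', assoc hbe, hbk]
      match_scalars; field_simp
    · simp only [pow_two k', mul_assoc, smul_mul_assoc, mul_smul_comm, assoc hk'f,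
        assoc hkk', assoc hbf, hbk]
      match_scalars; field_simp
    · simp only [pow_succ, pow_zero, one_mul, mul_assoc, assoc hkk', hbk, assoc hbk]
    · rw [← hρ, ← sub_eq_zero]
      trans k ^ 6 * k' ^ 2 * dolanGrady q (c * cb * (q + q⁻¹) ^ 2) a b
      · simp only [dolanGrady, pow_succ, pow_zero, one_mul, mul_add, mul_sub, mul_assoc,
          mul_smul_comm, assoc hkk', assoc hak, assoc hak', assoc hbk]
        module
      · rw [hab, mul_zero]
  rw [hZe, hZf, hZb, add_zero, add_zero]

end

/-- If `𝒜₀, 𝒜₁` satisfy the q-Dolan–Grady relations with parameters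
`ρ_i = c_i c̄_i (q + q⁻¹)²`, then the images `D_i = (c_i e_i K_i + c̄_i f_i K_i) ⊗ 1 + K_i² ⊗ 𝒜_i`
under the coaction map satisfy the same q-Dolan–Grady relations in `A ⊗[ℂ] B`. -/
theorem stmt_7 (q : ℂ) (hq0 : q ≠ 0) (hqroot : ∀ n : ℕ, 0 < n → q ^ n ≠ 1)
    (A : Type*) [Ring A] [Algebra ℂ A]
    (e f : Fin 2 → A) (K : Fin 2 → Aˣ)
    (hKcomm : (K 0 : A) * (K 1 : A) = (K 1 : A) * (K 0 : A))
    (hKeK : ∀ i, (K i : A) * e i * (((K i)⁻¹ : Aˣ) : A) = q • e i)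
    (hKfK : ∀ i, (K i : A) * f i * (((K i)⁻¹ : Aˣ) : A) = q⁻¹ • f i)
    (hKeK' : ∀ i j, i ≠ j → (K i : A) * e j * (((K i)⁻¹ : Aˣ) : A) = q⁻¹ • e j)
    (hKfK' : ∀ i j, i ≠ j → (K i : A) * f j * (((K i)⁻¹ : Aˣ) : A) = q • f j)
    (hef : ∀ i, e i * f i - f i * e i
      = (q - q⁻¹)⁻¹ • ((K i : A) ^ 2 - (((K i)⁻¹ : Aˣ) : A) ^ 2))
    (hef' : ∀ i j, i ≠ j → e i * f j = f j * e i)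
    (hSerre_e : ∀ i j, i ≠ j →
      e i ^ 3 * e j - (q ^ 2 + 1 + (q ^ 2)⁻¹) • (e i ^ 2 * e j * e i)
        + (q ^ 2 + 1 + (q ^ 2)⁻¹) • (e i * e j * e i ^ 2) - e j * e i ^ 3 = 0)
    (hSerre_f : ∀ i j, i ≠ j →
      f i ^ 3 * f j - (q ^ 2 + 1 + (q ^ 2)⁻¹) • (f i ^ 2 * f j * f i)
        + (q ^ 2 + 1 + (q ^ 2)⁻¹) • (f i * f j * f i ^ 2) - f j * f i ^ 3 = 0)
    (B : Type*) [Ring B] [Algebra ℂ B]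
    (c cb : Fin 2 → ℂ) (𝒜 : Fin 2 → B)
    (hDG : ∀ i j, i ≠ j →
      𝒜 i ^ 3 * 𝒜 j - (q ^ 2 + 1 + (q ^ 2)⁻¹) • (𝒜 i ^ 2 * 𝒜 j * 𝒜 i)
        + (q ^ 2 + 1 + (q ^ 2)⁻¹) • (𝒜 i * 𝒜 j * 𝒜 i ^ 2) - 𝒜 j * 𝒜 i ^ 3
      = (c i * cb i * (q + q⁻¹) ^ 2) • (𝒜 i * 𝒜 j - 𝒜 j * 𝒜 i))
    (D : Fin 2 → A ⊗[ℂ] B)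
    (hD : ∀ i, D i = (c i • (e i * (K i : A)) + cb i • (f i * (K i : A))) ⊗ₜ[ℂ] (1 : B)
      + ((K i : A) ^ 2) ⊗ₜ[ℂ] 𝒜 i) :
    ∀ i j, i ≠ j →
      D i ^ 3 * D j - (q ^ 2 + 1 + (q ^ 2)⁻¹) • (D i ^ 2 * D j * D i)
        + (q ^ 2 + 1 + (q ^ 2)⁻¹) • (D i * D j * D i ^ 2) - D j * D i ^ 3
      = (c i * cb i * (q + q⁻¹) ^ 2) • (D i * D j - D j * D i) := by
  intro i j hij
  have qcomm (m : Fin 2) {x : A} {s : ℂ}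
      (h : (K m : A) * x * (((K m)⁻¹ : Aˣ) : A) = s • x) : (K m : A) * x = s • (x * (K m : A)) := by
    rw [← smul_mul_assoc, ← h, Units.inv_mul_cancel_right]
  have hKK : (K j : A) * (K i : A) = (K i : A) * (K j : A) := by
    fin_cases i <;> fin_cases j <;> first | exact hKcomm | exact hKcomm.symm | rfl
  let φ : A →ₐ[ℂ] A ⊗[ℂ] B := Algebra.TensorProduct.includeLeft
  let ψ : B →ₐ[ℂ] A ⊗[ℂ] B := Algebra.TensorProduct.includeRight
  have comm (y : B) (x : A) : ψ y * φ x = φ x * ψ y := by simp [φ, ψ]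
  have lift {m : Fin 2} {x : A} {s : ℂ} (h : (K m : A) * x * (((K m)⁻¹ : Aˣ) : A) = s • x) :
      φ (K m) * φ x = s • (φ x * φ (K m)) := by
    rw [← map_mul, qcomm m h, map_smul, map_mul]
  have hDφ (m : Fin 2) : D m = c m • (φ (e m) * φ (K m)) + cb m • (φ (f m) * φ (K m))
      + φ (K m) ^ 2 * ψ (𝒜 m) := by
    rw [hD, ← map_mul, ← map_mul, ← map_smul, ← map_smul, ← map_add, ← map_pow]
    simp [φ, ψ]
  have serre {x y : A} (h : x ^ 3 * y - (q ^ 2 + 1 + (q ^ 2)⁻¹) • (x ^ 2 * y * x)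
      + (q ^ 2 + 1 + (q ^ 2)⁻¹) • (x * y * x ^ 2) - y * x ^ 3 = 0) :
      dolanGrady q 0 (φ x) (φ y) = 0 := by
    rw [← map_dolanGrady, dolanGrady_eq_zero_iff.mpr (by rw [h, zero_smul]), map_zero]
  rw [← dolanGrady_eq_zero_iff, hDφ, hDφ]
  refine dolanGrady_coaction (l := φ (((K i)⁻¹ : Aˣ) : A)) hq0 (hqroot 2 two_pos)
    (lift (hKeK i)) (lift (hKfK i)) (lift (hKeK' i j hij)) (lift (hKfK' i j hij))
    (lift (hKeK' j i hij.symm)) (lift (hKfK' j i hij.symm)) ?_ ?_ ?_ ?_ ?_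
    (serre (hSerre_e i j hij)) (serre (hSerre_f i j hij))
    (comm _ _) (comm _ _) (comm _ _) (comm _ _) (comm _ _) (comm _ _)
    (comm _ _) (comm _ _) (comm _ _) ?_
  · rw [← map_mul, hKK, map_mul]
  · rw [← map_mul, Units.inv_mul, map_one]
  · rw [← map_mul, ← map_mul, ← map_sub, hef, map_smul, map_sub, map_pow, map_pow]
  · rw [← map_mul, hef' i j hij, map_mul]
  · rw [← map_mul, hef' j i hij.symm, map_mul]
  · rw [← map_dolanGrady, dolanGrady_eq_zero_iff.mpr (hDG i j hij), map_zero]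
end

section
/- Fix n ≥ 2, let s ∈ ℂ with s ∉ {0, 1, −1}, set q = s², and let w : ℤ/(n+1)ℤ → ℂ. Then the constraints w_j (w_{j+1}² + 1/(q + q⁻¹ − 2)) = 0 and w_{j+1} (w_j² + 1/(q + q⁻¹ − 2)) = 0 hold for all j ∈ ℤ/(n+1)ℤ if and only if either w_j = 0 for all j, or for every j one has w_j = i/(s − s⁻¹) or w_j = −i/(s − s⁻¹) (where i denotes the imaginary unit). This is the classification of integrable fixed boundary conditions for the boundary a_n⁽¹⁾ affine Toda field theory. -/
/-- A property of `ZMod m` that holds somewhere and passes to successors holds everywhere. -/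
theorem ZMod.forall_of_exists_of_succ {m : ℕ} [NeZero m] {P : ZMod m → Prop}
    (hex : ∃ j, P j) (hsucc : ∀ j, P j → P (j + 1)) (k : ZMod m) : P k := by
  obtain ⟨j, hj⟩ := hex
  have hadd : ∀ i : ℕ, P (j + i) := by
    intro i
    induction i with
    | zero => simpa using hj
    | succ i ih =>
      have h := hsucc _ ih
      rwa [add_assoc, ← Nat.cast_succ] at h
  have h := hadd (k - j).val
  rwa [ZMod.natCast_zmod_val, add_sub_cancel] at h

theorem sub_inv_ne_zero_of_ne {K : Type*} [Field K] {s : K} (h0 : s ≠ 0) (h1 : s ≠ 1)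
    (hneg : s ≠ -1) : s - s⁻¹ ≠ 0 := by
  intro h
  have hsq : s * s = 1 := by
    nth_rewrite 2 [sub_eq_zero.mp h]
    exact mul_inv_cancel₀ h0
  exact (mul_self_eq_one_iff.mp hsq).elim h1 hneg

theorem one_div_sq_add_inv_sub_two {s : ℂ} (h0 : s ≠ 0) :
    1 / (s ^ 2 + (s ^ 2)⁻¹ - 2) = -(Complex.I / (s - s⁻¹)) ^ 2 := by
  have hsq : s ^ 2 + (s ^ 2)⁻¹ - 2 = (s - s⁻¹) ^ 2 := by
    field_simp
    ring
  rw [hsq, div_pow, Complex.I_sq, neg_div, neg_neg]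

/-- Classification of the integrable fixed boundary conditions for the
boundary `a_n⁽¹⁾` affine Toda field theory (`n ≥ 2`, nodes on the cycle `ZMod (n+1)`). -/
theorem stmt_12 (n : ℕ) (hn : 2 ≤ n)
    (s : ℂ) (hs0 : s ≠ 0) (hs1 : s ≠ 1) (hsm1 : s ≠ -1)
    (q : ℂ) (hq : q = s ^ 2) (w : ZMod (n + 1) → ℂ) :
    (∀ j : ZMod (n + 1),
      w j * (w (j + 1) ^ 2 + 1 / (q + q⁻¹ - 2)) = 0
      ∧ w (j + 1) * (w j ^ 2 + 1 / (q + q⁻¹ - 2)) = 0)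
    ↔ ((∀ j, w j = 0)
      ∨ (∀ j, w j = Complex.I / (s - s⁻¹) ∨ w j = -(Complex.I / (s - s⁻¹)))) := by
  subst hq
  rw [one_div_sq_add_inv_sub_two hs0]
  have ha : Complex.I / (s - s⁻¹) ≠ 0 :=
    div_ne_zero Complex.I_ne_zero (sub_inv_ne_zero_of_ne hs0 hs1 hsm1)
  generalize Complex.I / (s - s⁻¹) = a at ha ⊢
  simp only [← sub_eq_add_neg, ← sq_eq_sq_iff_eq_or_eq_neg]
  constructor
  · intro h
    by_cases hex : ∃ j, w j = 0
    · refine Or.inl (ZMod.forall_of_exists_of_succ hex fun j hj => ?_)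
      simpa [hj, ha] using (h j).2
    · push Not at hex
      exact Or.inr fun j => sub_eq_zero.mp
        ((mul_eq_zero.mp (h j).2).resolve_left (hex (j + 1)))
  · rintro (h | h) j <;> simp [h]
end

section
/- Fix n ≥ 3, let q ∈ ℂ with q ≠ 0 and q² ≠ 1, and let w₀, …, w_n ∈ ℂ. Suppose that for every pair (j,k) in the edge set E = {(0,2), (1,2)} ∪ {(k, k+1) : 2 ≤ k ≤ n−2} of simply-linked long-root nodes of b_n⁽¹⁾ both constraints w_j (w_k² + 1/(q² + q⁻² − 2)) = 0 and w_k (w_j² + 1/(q² + q⁻² − 2)) = 0 hold, and that the double-edge constraint w_n (w_{n−1}² + 1/(q² + q⁻² − 2)) = 0 holds. Then either w_j = 0 for all j ∈ {0, …, n}, or w_j² = −1/(q − q⁻¹)² for all j ∈ {0, …, n−1} with w_n unconstrained. Conversely, every such configuration satisfies all the constraints. This classifies the integrable fixed boundary conditions of the boundary b_n⁽¹⁾ affine Toda theory: besides the trivial one, ε_j = ±i/(q − q⁻¹) for j ≤ n−1 and ε_n arbitrary. -/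
/-- The symmetric constraints on a simply-linked pair force both parameters to vanish, or both
to square to `-c`. -/
theorem both_zero_or_both_sq_eq_neg {K : Type*} [Field K] {a b c : K} (hc : c ≠ 0)
    (hab : a * (b ^ 2 + c) = 0) (hba : b * (a ^ 2 + c) = 0) :
    (a = 0 ∧ b = 0) ∨ (a ^ 2 = -c ∧ b ^ 2 = -c) := by
  rcases mul_eq_zero.mp hab with ha | hb
  · left
    subst ha
    simpa [hc] using hba
  · right
    have hb0 : b ≠ 0 := by
      rintro rfl
      exact hc (by simpa using hb)
    exact ⟨eq_neg_of_add_eq_zero_left ((mul_eq_zero.mp hba).resolve_left hb0),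
      eq_neg_of_add_eq_zero_left hb⟩

/-- A property that holds at node `2` and passes along every simple link of `b_n⁽¹⁾` holds at
all long-root nodes. -/
theorem forall_long_nodes {n : ℕ} {P : ℕ → Prop} (h2 : P 2) (h0 : P 2 → P 0) (h1 : P 2 → P 1)
    (hs : ∀ j, 2 ≤ j → j ≤ n - 2 → P j → P (j + 1)) : ∀ j ≤ n - 1, P j := by
  have key : ∀ j, 2 ≤ j → j ≤ n - 1 → P j := by
    intro j hj
    induction j, hj using Nat.le_induction with
    | base => exact fun _ => h2
    | succ j hj ih => exact fun hjn => hs j hj (by omega) (ih (by omega))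
  intro j hj
  rcases (by omega : j = 0 ∨ j = 1 ∨ 2 ≤ j) with rfl | rfl | hj2
  · exact h0 h2
  · exact h1 h2
  · exact key j hj2 hj

/-- Classification of the integrable fixed boundary conditions of the
boundary `b_n⁽¹⁾` affine Toda theory (`n ≥ 3`): besides the trivial one, all long-node
parameters square to `−1/(q − q⁻¹)²` and the short-node parameter `w_n` is arbitrary. -/
theorem stmt_13 (n : ℕ) (hn : 3 ≤ n)
    (q : ℂ) (hq0 : q ≠ 0) (hq1 : q ^ 2 ≠ 1) (w : ℕ → ℂ) :
    ((∀ j k : ℕ,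
        ((j = 0 ∧ k = 2) ∨ (j = 1 ∧ k = 2) ∨ (2 ≤ j ∧ j ≤ n - 2 ∧ k = j + 1)) →
        w j * (w k ^ 2 + 1 / (q ^ 2 + (q ^ 2)⁻¹ - 2)) = 0
        ∧ w k * (w j ^ 2 + 1 / (q ^ 2 + (q ^ 2)⁻¹ - 2)) = 0)
      ∧ w n * (w (n - 1) ^ 2 + 1 / (q ^ 2 + (q ^ 2)⁻¹ - 2)) = 0)
    ↔ ((∀ j ≤ n, w j = 0)
      ∨ (∀ j ≤ n - 1, w j ^ 2 = -(1 / (q - q⁻¹) ^ 2))) := by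
  have hden : q ^ 2 + (q ^ 2)⁻¹ - 2 = (q - q⁻¹) ^ 2 := by
    field_simp
    ring
  have hsub : q - q⁻¹ ≠ 0 := by
    intro h
    apply hq1
    rw [sq]
    nth_rewrite 2 [sub_eq_zero.mp h]
    exact mul_inv_cancel₀ hq0
  rw [hden]
  have hc : 1 / (q - q⁻¹) ^ 2 ≠ 0 := one_div_ne_zero (pow_ne_zero 2 hsub)
  generalize 1 / (q - q⁻¹) ^ 2 = c at hc ⊢
  constructor
  · rintro ⟨hE, hlast⟩
    have pair := fun j k hjk =>
      both_zero_or_both_sq_eq_neg hc (hE j k hjk).1 (hE j k hjk).2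
    have zero_iff : ∀ j k, _ → (w j = 0 ↔ w k = 0) := fun j k hjk => by
      rcases pair j k hjk with ⟨ha, hb⟩ | ⟨ha, hb⟩
      · simp [ha, hb]
      · refine iff_of_false ?_ ?_ <;> intro h <;> simp_all
    have sq_iff : ∀ j k, _ → (w j ^ 2 = -c ↔ w k ^ 2 = -c) := fun j k hjk => by
      rcases pair j k hjk with ⟨ha, hb⟩ | ⟨ha, hb⟩ <;> simp [ha, hb]
    rcases pair 0 2 (by simp) with ⟨-, h2⟩ | ⟨-, h2⟩
    · left
      have hlong : ∀ j ≤ n - 1, w j = 0 :=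
        forall_long_nodes h2 (zero_iff 0 2 (by simp)).mpr (zero_iff 1 2 (by simp)).mpr
          fun j hj hjn => (zero_iff j (j + 1) (by simp [hj, hjn])).mp
      intro j hj
      rcases (by omega : j ≤ n - 1 ∨ j = n) with hj | rfl
      · exact hlong j hj
      · simpa [hlong (j - 1) le_rfl, hc] using hlast
    · right
      exact forall_long_nodes h2 (sq_iff 0 2 (by simp)).mpr (sq_iff 1 2 (by simp)).mpr
        fun j hj hjn => (sq_iff j (j + 1) (by simp [hj, hjn])).mp
  · rintro (h | h)
    · refine ⟨fun j k hjk => ?_, by simp [h n le_rfl]⟩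
      simp [h j (by omega), h k (by omega)]
    · refine ⟨fun j k hjk => ?_, by simp [h (n - 1) le_rfl]⟩
      simp [h j (by omega), h k (by omega)]
end

section
/- Let q ∈ ℂ with q ≠ 0, q + q⁻¹ ≠ 2 and q³ + q⁻³ ≠ 2, and let w₀, w₁, w₂ ∈ ℂ. Then the system of constraint equations for g₂⁽¹⁾, namely (i) w₀ (w₁² + 1/(q³ + q⁻³ − 2)) = 0, (ii) w₁ (w₀² + 1/(q³ + q⁻³ − 2)) = 0, (iii) w₂ (w₁² + 1/(q³ + q⁻³ − 2)) = 0, and (iv) w₁ (w₂² + 1/(q + q⁻¹ − 2)) (w₂² + (q + q⁻¹ − 1)²/(q + q⁻¹ − 2)) = 0, holds if and only if either w₀ = w₁ = w₂ = 0, or w₀² = w₁² = −1/(q³ + q⁻³ − 2) and (w₂² = −1/(q + q⁻¹ − 2) or w₂² = −(q + q⁻¹ − 1)²/(q + q⁻¹ − 2)). This classifies the integrable fixed boundary conditions of the boundary g₂⁽¹⁾ affine Toda theory. -/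
/-- Classification of the integrable fixed boundary conditions of the
boundary `g₂⁽¹⁾` affine Toda theory. -/
theorem stmt_14 (q : ℂ) (hq0 : q ≠ 0)
    (h1 : q + q⁻¹ ≠ 2) (h2 : q ^ 3 + (q ^ 3)⁻¹ ≠ 2) (w₀ w₁ w₂ : ℂ) :
    (w₀ * (w₁ ^ 2 + 1 / (q ^ 3 + (q ^ 3)⁻¹ - 2)) = 0
      ∧ w₁ * (w₀ ^ 2 + 1 / (q ^ 3 + (q ^ 3)⁻¹ - 2)) = 0
      ∧ w₂ * (w₁ ^ 2 + 1 / (q ^ 3 + (q ^ 3)⁻¹ - 2)) = 0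
      ∧ w₁ * (w₂ ^ 2 + 1 / (q + q⁻¹ - 2))
          * (w₂ ^ 2 + (q + q⁻¹ - 1) ^ 2 / (q + q⁻¹ - 2)) = 0)
    ↔ ((w₀ = 0 ∧ w₁ = 0 ∧ w₂ = 0)
      ∨ (w₀ ^ 2 = -(1 / (q ^ 3 + (q ^ 3)⁻¹ - 2))
        ∧ w₁ ^ 2 = -(1 / (q ^ 3 + (q ^ 3)⁻¹ - 2))
        ∧ (w₂ ^ 2 = -(1 / (q + q⁻¹ - 2))
          ∨ w₂ ^ 2 = -((q + q⁻¹ - 1) ^ 2 / (q + q⁻¹ - 2))))) := by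
  have hc : 1 / (q ^ 3 + (q ^ 3)⁻¹ - 2) ≠ 0 := one_div_ne_zero (sub_ne_zero.mpr h2)
  generalize 1 / (q ^ 3 + (q ^ 3)⁻¹ - 2) = c at hc ⊢
  generalize 1 / (q + q⁻¹ - 2) = a
  generalize (q + q⁻¹ - 1) ^ 2 / (q + q⁻¹ - 2) = b
  simp only [← add_eq_zero_iff_eq_neg, mul_eq_zero]
  by_cases hw₁ : w₁ = 0
  · simp [hw₁, hc]
  · by_cases hw₀ : w₀ = 0
    · simp [hw₀, hw₁, hc]
    · simp only [hw₀, hw₁, false_or, false_and]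
      tauto
end

section
/- Let q ∈ ℂ with q ≠ 0, q + q⁻¹ ∉ {1, 2} and q³ + q⁻³ ≠ 2, and let w₀, w₁, w₂ ∈ ℂ. Then the system of constraint equations for d₄⁽³⁾, namely (i) w₀ (w₁² + 1/(q + q⁻¹ − 2)) = 0, (ii) w₁ (w₀² + 1/(q + q⁻¹ − 2)) = 0, (iii) w₁ (w₂² + 1/(q³ + q⁻³ − 2)) = 0, and (iv) w₂ (w₁² + 1/(q + q⁻¹ − 2)) (w₁² + (q + q⁻¹ − 1)²/(q + q⁻¹ − 2)) = 0, holds if and only if either w₀ = w₁ = w₂ = 0, or w₀² = w₁² = −1/(q + q⁻¹ − 2) and w₂² = −1/(q³ + q⁻³ − 2). This classifies the integrable fixed boundary conditions of the boundary d₄⁽³⁾ affine Toda theory: there is a single nontrivial family ε_j = ±i/(q_j^{1/2} − q_j^{−1/2}) for all j. -/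
/-- Classification of the integrable fixed boundary conditions of the
boundary `d₄⁽³⁾` affine Toda theory: a single nontrivial family. -/
theorem stmt_15 (q : ℂ) (hq0 : q ≠ 0)
    (h1 : q + q⁻¹ ≠ 1) (h2 : q + q⁻¹ ≠ 2) (h3 : q ^ 3 + (q ^ 3)⁻¹ ≠ 2)
    (w₀ w₁ w₂ : ℂ) :
    (w₀ * (w₁ ^ 2 + 1 / (q + q⁻¹ - 2)) = 0
      ∧ w₁ * (w₀ ^ 2 + 1 / (q + q⁻¹ - 2)) = 0
      ∧ w₁ * (w₂ ^ 2 + 1 / (q ^ 3 + (q ^ 3)⁻¹ - 2)) = 0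
      ∧ w₂ * (w₁ ^ 2 + 1 / (q + q⁻¹ - 2))
          * (w₁ ^ 2 + (q + q⁻¹ - 1) ^ 2 / (q + q⁻¹ - 2)) = 0)
    ↔ ((w₀ = 0 ∧ w₁ = 0 ∧ w₂ = 0)
      ∨ (w₀ ^ 2 = -(1 / (q + q⁻¹ - 2))
        ∧ w₁ ^ 2 = -(1 / (q + q⁻¹ - 2))
        ∧ w₂ ^ 2 = -(1 / (q ^ 3 + (q ^ 3)⁻¹ - 2)))) := by
  have ha : 1 / (q + q⁻¹ - 2) ≠ 0 := one_div_ne_zero (sub_ne_zero.2 h2)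
  have hb : (q + q⁻¹ - 1) ^ 2 / (q + q⁻¹ - 2) ≠ 0 :=
    div_ne_zero (pow_ne_zero 2 (sub_ne_zero.2 h1)) (sub_ne_zero.2 h2)
  constructor
  · rintro ⟨e₁, e₂, e₃, e₄⟩
    by_cases hw₁ : w₁ = 0
    · subst hw₁
      rw [zero_pow two_ne_zero, zero_add] at e₁ e₄
      rw [zero_add] at e₄
      exact Or.inl ⟨(mul_eq_zero.1 e₁).resolve_right ha, rfl,
        (mul_eq_zero.1 ((mul_eq_zero.1 e₄).resolve_right hb)).resolve_right ha⟩
    · have hw₀_sq := eq_neg_of_add_eq_zero_left ((mul_eq_zero.1 e₂).resolve_left hw₁)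
      have hw₂_sq := eq_neg_of_add_eq_zero_left ((mul_eq_zero.1 e₃).resolve_left hw₁)
      have hw₀ : w₀ ≠ 0 := by
        rintro rfl
        rw [zero_pow two_ne_zero] at hw₀_sq
        exact neg_ne_zero.2 ha hw₀_sq.symm
      exact Or.inr ⟨hw₀_sq,
        eq_neg_of_add_eq_zero_left ((mul_eq_zero.1 e₁).resolve_left hw₀), hw₂_sq⟩
  · rintro (⟨rfl, rfl, rfl⟩ | ⟨e₀, e₁, e₂⟩)
    · simp only [zero_mul, and_self]
    · simp only [e₀, e₁, e₂, neg_add_cancel, mul_zero, zero_mul, and_self]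
end
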